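/- For all integers m,n with 1 ≤ m ≤ n−2 and (m,n) ≠ (1,3): φ^(m)(n) = ⌊1 − ε_m + ε_m·(m+1)^{⌈ν_m·(m+1)^{⌈ν_{m+1}·(m+2)^{···^{⌈ν_{n−2}·(n−1)⌉}}⌉}⌉}⌋. Precisely, defining integers E_j for m ≤ j ≤ n−2 by downward recursion E_{n−2} := ⌈ν_{n−2}·(n−1)⌉ and E_j := ⌈ν_j·(j+1)^{E_{j+1}}⌉ for m ≤ j ≤ n−3, one has φ^(m)(n) = ⌊1 − ε_m + ε_m·(m+1)^{E_m}⌋. -/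

import Mathlib

open List Filter

open scoped Classical

noncomputable section

/-- The curling number of a finite string: the largest `k` such that
`S = X ++ Y^k` with `Y` nonempty; by convention `curl [] = 1`. -/
def curl (S : List ℕ) : ℕ :=
  max 1 (sSup {k | ∃ X Y : List ℕ, Y ≠ [] ∧ S = X ++ (List.replicate k Y).flatten})

/-- The prefix of length `n` of the level-`m` Gijswijt sequence `A^(m)`. -/
def gPrefix (m : ℕ) : ℕ → List ℕ
  | 0 => []
  | n + 1 => gPrefix m n ++ [max m (curl (gPrefix m n))]

/-- `gij m p` is the `p`-th term (1-indexed) of the level-`m` Gijswijt sequence `A^(m)`. -/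
def gij (m p : ℕ) : ℕ := max m (curl (gPrefix m (p - 1)))

/-- Standing hypothesis: for every `m ≥ 1`, the sets
`{k ≥ 0 : C(A^(m)[1,k]) ≤ m}` and `{k ≥ 0 : C(A^(m+1)[1,k]) ≤ m}` are infinite. -/
def StandingHyp : Prop :=
  ∀ m : ℕ, 1 ≤ m →
    {k : ℕ | curl (gPrefix m k) ≤ m}.Infinite ∧
    {k : ℕ | curl (gPrefix (m + 1) k) ≤ m}.Infinite

/-- Length of `π^(m)(1,x)`: the `x`-th smallest (0-indexed) element of
`{k : C(A^(m)[1,k]) ≤ m}`. -/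
def piLen (m x : ℕ) : ℕ := Nat.nth (fun k => curl (gPrefix m k) ≤ m) x

/-- `π^(m)(1,x)`: the prefix of `A^(m)` with exactly `x` occurrences of `m`
and curling number at most `m`. -/
def piStr (m x : ℕ) : List ℕ := gPrefix m (piLen m x)

/-- `β^(m)(t)`, the length of `B_t^(m)`. -/
def beta (m t : ℕ) : ℕ := piLen m ((m + 1) ^ (t - 1))

/-- `B_t^(m) := π^(m)(1,(m+1)^(t-1))`. -/
def Bstr (m t : ℕ) : List ℕ := piStr m ((m + 1) ^ (t - 1))

/-- `τ^(m)(t)`, the length of `T_t^(m)`. -/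
def tau (m t : ℕ) : ℕ := Nat.nth (fun k => curl (gPrefix (m + 1) k) ≤ m) (t - 1)

/-- `T_t^(m)`: the `t`-th shortest prefix of `A^(m+1)` with curling number at most `m`. -/
def Tstr (m t : ℕ) : List ℕ := gPrefix (m + 1) (tau m t)

/-- `φ^(m)(n)`: the least `p ≥ 1` with `A^(m)(p) = n`. -/
def phi (m n : ℕ) : ℕ := sInf {p : ℕ | 1 ≤ p ∧ gij m p = n}

/-- `t^(m)(n) = 1 + log_{m+1} #\{i ≤ φ^(m)(n) : A^(m)(i) = m\}`. -/
def tfun (m n : ℕ) : ℕ := 1 + Nat.log (m + 1) ((gPrefix m (phi m n)).count m)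

/-- `χ^(b)(a)`: read the base-`b` digits of `a` as base-`(b+1)` digits. -/
def chi (b a : ℕ) : ℕ := Nat.ofDigits (b + 1) (Nat.digits b a)

/-- `ι_m(t)`: read the base-`(m+2)` digits of the number of occurrences of `m+1`
in `T_t^(m)` as base-`(m+1)` digits. -/
def iota (m t : ℕ) : ℕ :=
  Nat.ofDigits (m + 1) (Nat.digits (m + 2) ((Tstr m t).count (m + 1)))

/-- `ι_m⁻¹(p)`: the largest `x ≥ 1` with `ι_m(x) ≤ p`. -/
def iotaInv (m p : ℕ) : ℕ := sSup {x : ℕ | 1 ≤ x ∧ iota m x ≤ p}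

/-- `ord_b(n)`: the `b`-adic valuation of `n`. -/
def ordb (b n : ℕ) : ℕ := sSup {z : ℕ | b ^ z ∣ n}

/-- The largest base-`b` digit of `n`. -/
def maxdigit (b n : ℕ) : ℕ := (Nat.digits b n).foldr max 0

/-- Auxiliary function for the level-`m` expansion: `lexpAux m a k = a_{m+1+k}`. -/
def lexpAux (m a : ℕ) : ℕ → ℕ
  | 0 => a
  | k + 1 => iota (m + 1 + k) (ordb (m + 1 + k) (lexpAux m a k) + 1)

/-- `lexp m a l = a_l`, the `l`-th term of the level-`m` expansion of `a`. -/
def lexp (m a l : ℕ) : ℕ := lexpAux m a (l - (m + 1))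

/-- The last element `n` of `π^(m+1)(1, χ^(m+1)(a))`; the level-`m` expansion
of `a` is `a_{m+1}, …, a_n`. -/
def levelEnd (m a : ℕ) : ℕ := (piStr (m + 1) (chi (m + 1) a)).getLastD 0

/-- `V_m := {v ≥ 0 : C(T_{v+1}^(m+1)) ≤ m}`. -/
def Vset (m : ℕ) : Set ℕ := {v | curl (Tstr (m + 1) (v + 1)) ≤ m}

/-- `Q := {α ≥ 0 : C(T_{α+1}^(2)) = 1}`. -/
def Qset : Set ℕ := {a | curl (Tstr 2 (a + 1)) = 1}

/-- `R := {(a,b) : a ∈ Q, a < b, no suffix S of T_{a+1}^(2) with T_{a+1}^(2)·S = T_{b+1}^(2)}`. -/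
def Rset : Set (ℕ × ℕ) :=
  {p | p.1 ∈ Qset ∧ p.1 < p.2 ∧
    ¬∃ S : List ℕ, S <:+ Tstr 2 (p.1 + 1) ∧ Tstr 2 (p.1 + 1) ++ S = Tstr 2 (p.2 + 1)}

/-- The digit of `x` in base `b` at (1-indexed) position `i`, i.e. the coefficient
of `b^(i-1)`. -/
def digitAt (b x i : ℕ) : ℕ := (Nat.digits b x).getD (i - 1) 0

/-- `u` is the (1-indexed) position of the second nonzero base-`b` digit of `x`
(the first nonzero digit being at position `ord_b(x)+1`). -/
def IsSecondNonzero (b x u : ℕ) : Prop :=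
  ordb b x + 1 < u ∧ digitAt b x u ≠ 0 ∧
    ∀ i, ordb b x + 1 < i → i < u → digitAt b x i = 0

/-- `𝒮_b`: pairs `(a,a')` with `1 ≤ a < a'` such that for some position `y` the
base-`b` digits of `a` and `a'` agree away from `y` and twice the `y`-th digit of `a`
is at least the `y`-th digit of `a'`. -/
def Sset (b : ℕ) : Set (ℕ × ℕ) :=
  {p | 1 ≤ p.1 ∧ p.1 < p.2 ∧
    ∃ y : ℕ, (∀ i, i ≠ y → (Nat.digits b p.1).getD i 0 = (Nat.digits b p.2).getD i 0) ∧
      (Nat.digits b p.2).getD y 0 ≤ 2 * (Nat.digits b p.1).getD y 0}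

/-- The glue string `S_t^(m)`, so that `T_{t+1}^(m) = T_t^(m) ++ glue m t`. -/
def glue (m t : ℕ) : List ℕ := (gPrefix (m + 1) (tau m (t + 1))).drop (tau m t)

/-- The strings `P_t^(m)`: `P_1^(m) = (m)` and `P_{t+1}^(m) = P_t^(m)·B_t^(m)·S_t^(m)`. -/
def Pstr (m : ℕ) : ℕ → List ℕ
  | 0 => []
  | 1 => [m]
  | t + 2 => Pstr m (t + 1) ++ Bstr m (t + 1) ++ glue m (t + 1)

end

/-! ### Powers of lists and the curling number -/

/-- The `k`-fold repetition of a list. -/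
def rep {α : Type*} (k : ℕ) (Y : List α) : List α := (List.replicate k Y).flatten

section Rep

variable {α β : Type*}

@[simp] lemma rep_zero (Y : List α) : rep 0 Y = [] := rfl

@[simp] lemma rep_one (Y : List α) : rep 1 Y = Y := by simp [rep]

lemma rep_succ (k : ℕ) (Y : List α) : rep (k + 1) Y = Y ++ rep k Y := by
  simp [rep, List.replicate_succ]

lemma rep_add (k l : ℕ) (Y : List α) : rep (k + l) Y = rep k Y ++ rep l Y := by
  simp only [rep, List.replicate_add, List.flatten_append]

lemma rep_succ' (k : ℕ) (Y : List α) : rep (k + 1) Y = rep k Y ++ Y := by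
  rw [rep_add, rep_one]

@[simp] lemma length_rep (k : ℕ) (Y : List α) : (rep k Y).length = k * Y.length := by
  induction k with
  | zero => simp
  | succ k ih => rw [rep_succ, List.length_append, ih]; ring

lemma flatMap_rep (f : α → List β) (k : ℕ) (Y : List α) :
    (rep k Y).flatMap f = rep k (Y.flatMap f) := by
  induction k with
  | zero => simp
  | succ k ih => rw [rep_succ, rep_succ, List.flatMap_append, ih]

lemma mem_rep {a : α} {k : ℕ} {Y : List α} (h : a ∈ rep k Y) : a ∈ Y := by
  simp only [rep, List.mem_flatten, List.mem_replicate] at h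
  obtain ⟨l, ⟨-, rfl⟩, h⟩ := h
  exact h

/-- Conjugation of powers: `(A ++ B)^k ++ A = A ++ (B ++ A)^k`. -/
lemma rep_append_comm (k : ℕ) (A B : List α) :
    rep k (A ++ B) ++ A = A ++ rep k (B ++ A) := by
  induction k with
  | zero => simp
  | succ k ih => rw [rep_succ, rep_succ, List.append_assoc, ih]; simp

end Rep

lemma bddAbove_curl (S : List ℕ) :
    BddAbove {k | ∃ X Y : List ℕ, Y ≠ [] ∧ S = X ++ (List.replicate k Y).flatten} := by
  refine ⟨S.length, ?_⟩
  rintro k ⟨X, Y, hY, h⟩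
  have h1 : S.length = X.length + k * Y.length := by
    rw [h, List.length_append, ← length_rep]; rfl
  have h2 : 1 ≤ Y.length := List.length_pos_iff.2 hY
  nlinarith

lemma one_le_curl (S : List ℕ) : 1 ≤ curl S := le_max_left _ _

lemma le_curl {S X Y : List ℕ} {k : ℕ} (hY : Y ≠ []) (h : S = X ++ rep k Y) : k ≤ curl S :=
  (le_csSup (bddAbove_curl S) ⟨X, Y, hY, h⟩).trans (le_max_right _ _)

lemma exists_rep_of_le_curl {S : List ℕ} {k : ℕ} (hk : 2 ≤ k) (h : k ≤ curl S) :
    ∃ X Y : List ℕ, Y ≠ [] ∧ S = X ++ rep k Y := by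
  have hne : {k | ∃ X Y : List ℕ, Y ≠ [] ∧
      S = X ++ (List.replicate k Y).flatten}.Nonempty := ⟨0, S, [0], by simp, by simp⟩
  obtain ⟨X, Y, hY, hS⟩ := Nat.sSup_mem hne (bddAbove_curl S)
  have h1 : k ≤ sSup {k | ∃ X Y : List ℕ, Y ≠ [] ∧
      S = X ++ (List.replicate k Y).flatten} := by
    rcases le_max_iff.1 h with h | h
    · omega
    · exact h
  obtain ⟨d, hd⟩ := Nat.exists_eq_add_of_le' h1
  refine ⟨X ++ rep d Y, Y, hY, ?_⟩
  rw [List.append_assoc, ← rep_add, ← hd]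
  exact hS

lemma curl_le_of_suffix {S U : List ℕ} (h : U <:+ S) : curl U ≤ curl S := by
  rcases Nat.lt_or_ge (curl U) 2 with h2 | h2
  · have := one_le_curl S; omega
  · obtain ⟨X, Y, hY, hU⟩ := exists_rep_of_le_curl h2 le_rfl
    obtain ⟨W, rfl⟩ := h
    exact le_curl (X := W ++ X) hY (by rw [List.append_assoc, ← hU])

lemma curl_le {S : List ℕ} {c : ℕ} (hc : 1 ≤ c)
    (h : ∀ (X Y : List ℕ) (k : ℕ), Y ≠ [] → S = X ++ rep k Y → 2 ≤ k → k ≤ c) : curl S ≤ c := by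
  by_contra hlt
  obtain ⟨X, Y, hY, hS⟩ := exists_rep_of_le_curl (S := S) (k := curl S) (by omega) le_rfl
  exact hlt (h X Y _ hY hS (by omega))

lemma curl_concat_of_notMem {P : List ℕ} {n : ℕ} (hn : n ∉ P) : curl (P ++ [n]) = 1 := by
  refine le_antisymm (curl_le le_rfl fun X Y k hY h hk => ?_) (one_le_curl _)
  exfalso
  obtain ⟨Y', y, rfl⟩ := List.eq_nil_or_concat'  Y |>.resolve_left hY
  obtain ⟨k, rfl⟩ : ∃ l, k = l + 2 := ⟨k - 2, by omega⟩
  rw [rep_succ', rep_succ'] at h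
  simp only [← List.append_assoc] at h
  obtain ⟨h1, h2⟩ := List.append_inj' h rfl
  simp only [List.cons.injEq, and_true] at h2
  subst h2
  apply hn
  rw [h1]
  simp

lemma curl_nil : curl [] = 1 := by
  refine le_antisymm (curl_le le_rfl fun X Y k hY h hk => ?_) (one_le_curl _)
  have h1 := congrArg List.length h
  have h2 : 1 ≤ Y.length := List.length_pos_iff.2 hY
  rw [List.length_append, length_rep, List.length_nil] at h1
  nlinarith

/-! ### Prefixes of the Gijswijt sequences -/

@[simp] lemma length_gPrefix (m k : ℕ) : (gPrefix m k).length = k := by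
  induction k with
  | zero => rfl
  | succ k ih => simp [gPrefix, ih]

lemma gPrefix_prefix (m : ℕ) {k l : ℕ} (h : k ≤ l) : gPrefix m k <+: gPrefix m l := by
  induction h with
  | refl => exact List.prefix_refl _
  | step _ ih => exact ih.trans (List.prefix_append _ _)

lemma le_of_mem_gPrefix {m k a : ℕ} (h : a ∈ gPrefix m k) : m ≤ a := by
  induction k with
  | zero => simp [gPrefix] at h
  | succ k ih =>
    simp only [gPrefix, List.mem_append, List.mem_singleton] at h
    rcases h with h | h
    · exact ih h
    · rw [h]; exact le_max_left _ _

lemma notMem_gPrefix {m k a : ℕ} (h : a < m) : a ∉ gPrefix m k := fun h' =>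
  absurd (le_of_mem_gPrefix h') (by omega)

lemma gPrefix_injective (m : ℕ) : Function.Injective (gPrefix m) := fun k l h => by
  simpa using congrArg List.length h

/-! ### Multiplicities -/

/-- The exponent of the largest power of `b` dividing `x`. -/
noncomputable def vl (b x : ℕ) : ℕ := multiplicity b x

section Valuation

variable {b : ℕ}

lemma pow_dvd_iff_le_vl (hb : 2 ≤ b) {x : ℕ} (hx : 0 < x) (e : ℕ) : b ^ e ∣ x ↔ e ≤ vl b x :=
  FiniteMultiplicity.pow_dvd_iff_le_multiplicity
    (Nat.finiteMultiplicity_iff.2 ⟨by omega, hx⟩)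

lemma vl_eq (hb : 2 ≤ b) {x e : ℕ} (h1 : b ^ e ∣ x) (h2 : ¬ b ^ (e + 1) ∣ x) : vl b x = e := by
  have hx : 0 < x := Nat.pos_of_ne_zero fun h => h2 (h ▸ dvd_zero _)
  rw [pow_dvd_iff_le_vl hb hx] at h1 h2
  omega

lemma pow_vl_dvd (hb : 2 ≤ b) {x : ℕ} (hx : 0 < x) : b ^ vl b x ∣ x :=
  (pow_dvd_iff_le_vl hb hx _).2 le_rfl

lemma not_pow_vl_succ_dvd (hb : 2 ≤ b) {x : ℕ} (hx : 0 < x) : ¬ b ^ (vl b x + 1) ∣ x := by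
  rw [pow_dvd_iff_le_vl hb hx]; omega

lemma vl_pow (hb : 2 ≤ b) (u : ℕ) : vl b (b ^ u) = u :=
  vl_eq hb dvd_rfl fun h => by
    have := (Nat.pow_dvd_pow_iff_le_right (by omega : 1 < b)).1 h; omega

lemma vl_lt (hb : 2 ≤ b) {x e : ℕ} (hx : 0 < x) (h : x < b ^ e) : vl b x < e := by
  by_contra hlt
  have := Nat.le_of_dvd hx ((pow_dvd_iff_le_vl hb hx e).2 (by omega))
  omega

lemma vl_eq_zero (hb : 2 ≤ b) {x : ℕ} (h : ¬ b ∣ x) : vl b x = 0 :=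
  vl_eq hb (by simp) (by simpa using h)

lemma vl_add (hb : 2 ≤ b) {c x e : ℕ} (hc : b ^ e ∣ c) (hx : 0 < x) (h : vl b x < e) :
    vl b (c + x) = vl b x := by
  have h1 : b ^ vl b x ∣ c := (pow_dvd_pow b h.le).trans hc
  have h2 : b ^ (vl b x + 1) ∣ c := (pow_dvd_pow b h).trans hc
  refine vl_eq hb ?_ ?_
  · rw [Nat.dvd_add_right h1]; exact pow_vl_dvd hb hx
  · rw [Nat.dvd_add_right h2]; exact not_pow_vl_succ_dvd hb hx

lemma vl_mul_self (hb : 2 ≤ b) {x : ℕ} (hx : 0 < x) : vl b (b * x) = vl b x + 1 := by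
  refine vl_eq hb ?_ ?_
  · rw [pow_succ']; exact Nat.mul_dvd_mul_left _ (pow_vl_dvd hb hx)
  · rw [pow_succ']
    intro h
    exact not_pow_vl_succ_dvd hb hx (Nat.dvd_of_mul_dvd_mul_left (by omega) h)

lemma vl_mul_pow (hb : 2 ≤ b) {x : ℕ} (hx : 0 < x) (e : ℕ) :
    vl b (b ^ e * x) = vl b x + e := by
  induction e with
  | zero => simp
  | succ e ih =>
    rw [pow_succ', mul_assoc, vl_mul_self hb (by positivity), ih]; ring

end Valuation

/-! ### Decomposition of a word at the occurrences of a letter -/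

/-- The concatenation of the words `m :: B` for `B` in a list of words. -/
def blk (m : ℕ) (Bs : List (List ℕ)) : List ℕ := Bs.flatMap (fun B => m :: B)

@[simp] lemma blk_nil (m : ℕ) : blk m [] = [] := rfl

@[simp] lemma blk_append (m : ℕ) (A B : List (List ℕ)) :
    blk m (A ++ B) = blk m A ++ blk m B := by simp [blk]

@[simp] lemma blk_singleton (m : ℕ) (B : List ℕ) : blk m [B] = m :: B := by simp [blk]

@[simp] lemma blk_cons (m : ℕ) (B : List ℕ) (Bs : List (List ℕ)) :
    blk m (B :: Bs) = m :: (B ++ blk m Bs) := by simp [blk]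

lemma blk_rep (m k : ℕ) (A : List (List ℕ)) : blk m (rep k A) = rep k (blk m A) :=
  flatMap_rep _ _ _

/-- Splits a word at the occurrences of the letter `m`. -/
def dec (m : ℕ) : List ℕ → List ℕ × List (List ℕ)
  | [] => ([], [])
  | a :: l => if a = m then ([], (dec m l).1 :: (dec m l).2) else (a :: (dec m l).1, (dec m l).2)

lemma dec_append_blk {m : ℕ} (Cs : List (List ℕ)) (hC : ∀ C ∈ Cs, m ∉ C) (B : List ℕ)
    (hB : m ∉ B) : dec m (B ++ blk m Cs) = (B, Cs) := by
  induction Cs generalizing B with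
  | nil =>
    induction B with
    | nil => rfl
    | cons a B ih =>
      simp only [List.mem_cons, not_or] at hB
      have := ih hB.2
      simp only [blk_nil, List.append_nil] at this ⊢
      rw [dec, if_neg (Ne.symm hB.1), this]
  | cons C Cs ihC =>
    induction B with
    | nil =>
      rw [List.nil_append, blk_cons, dec, if_pos rfl,
        ihC (fun D hD => hC D (List.mem_cons_of_mem _ hD)) C (hC C List.mem_cons_self)]
    | cons a B ih =>
      simp only [List.mem_cons, not_or] at hB
      rw [List.cons_append, dec, if_neg (Ne.symm hB.1), ih hB.2]

lemma exists_eq_append_blk (m : ℕ) (l : List ℕ) :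
    ∃ B Cs, m ∉ B ∧ (∀ C ∈ Cs, m ∉ C) ∧ l = B ++ blk m Cs := by
  induction l with
  | nil => exact ⟨[], [], by simp, by simp, rfl⟩
  | cons a l ih =>
    obtain ⟨B, Cs, hB, hC, rfl⟩ := ih
    by_cases h : a = m
    · subst h
      exact ⟨[], B :: Cs, by simp, by simpa using ⟨hB, hC⟩, by simp⟩
    · exact ⟨a :: B, Cs, by simpa using ⟨Ne.symm h, hB⟩, hC, rfl⟩

lemma append_blk_inj {m : ℕ} {B B' : List ℕ} {Cs Cs' : List (List ℕ)} (hB : m ∉ B)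
    (hB' : m ∉ B') (hC : ∀ C ∈ Cs, m ∉ C) (hC' : ∀ C ∈ Cs', m ∉ C)
    (h : B ++ blk m Cs = B' ++ blk m Cs') : B = B' ∧ Cs = Cs' := by
  have := congrArg (dec m) h
  rw [dec_append_blk _ hC _ hB, dec_append_blk _ hC' _ hB'] at this
  simpa using this

/-- A repetition at the end of a word, whose period contains the letter `m`, comes from a
repetition of the list of factors between the occurrences of `m`. -/
lemma blk_eq_append_rep {m j : ℕ} {Ls : List (List ℕ)} {U X Z : List ℕ}
    (hL : ∀ B ∈ Ls, m ∉ B) (hU : m ∉ U) (hmZ : m ∈ Z)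
    (h : blk m (Ls ++ [U]) = X ++ rep (j + 1) Z) :
    ∃ (As Q : List (List ℕ)) (Z1 : List ℕ), Ls = As ++ rep j (Q ++ [U ++ Z1]) ++ Q ∧
      (As = [] → Z1 = []) ∧ ∀ As' A, As = As' ++ [A] → Z1 <:+ A := by
  obtain ⟨Z1, Cs, hZ1, hCs, rfl⟩ := exists_eq_append_blk m Z
  have hCne : Cs ≠ [] := by
    rintro rfl
    simp only [blk_nil, List.append_nil] at hmZ
    exact hZ1 hmZ
  obtain ⟨Q, q, rfl⟩ := List.eq_nil_or_concat' Cs |>.resolve_left hCne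
  obtain ⟨A0, As, hA0, hAs, hXA⟩ := exists_eq_append_blk m (X ++ Z1)
  have hQ : ∀ C ∈ Q, m ∉ C := fun C hC => hCs C (by simp [hC])
  have hq : m ∉ q := hCs q (by simp)
  have hqZ : m ∉ q ++ Z1 := by simp [hq, hZ1]
  have key : X ++ rep (j + 1) (Z1 ++ blk m (Q ++ [q]))
      = A0 ++ blk m (As ++ rep j (Q ++ [q ++ Z1]) ++ Q ++ [q]) := by
    rw [rep_succ', ← List.append_assoc (rep j _), rep_append_comm]
    have e1 : blk m (Q ++ [q]) ++ Z1 = blk m (Q ++ [q ++ Z1]) := by simp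
    rw [e1]
    simp only [blk_append m _ Q, blk_append m _ [q], blk_append m As, blk_rep]
    simp only [← List.append_assoc]
    rw [hXA]
  rw [key] at h
  have hall : ∀ C ∈ As ++ rep j (Q ++ [q ++ Z1]) ++ Q ++ [q], m ∉ C := by
    intro C hC
    simp only [List.mem_append, List.mem_singleton] at hC
    rcases hC with ((hC | hC) | hC) | hC
    · exact hAs C hC
    · have := mem_rep hC
      simp only [List.mem_append, List.mem_singleton] at this
      rcases this with h | rfl
      · exact hQ C h
      · exact hqZ
    · exact hQ C hC
    · rw [hC]; exact hq
  have hLU : ∀ C ∈ Ls ++ [U], m ∉ C := by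
    intro C hC
    simp only [List.mem_append, List.mem_singleton] at hC
    rcases hC with hC | rfl
    · exact hL C hC
    · exact hU
  obtain ⟨h1, h2⟩ := append_blk_inj (B := []) (by simp) hA0 hLU hall (by simpa using h)
  obtain ⟨h3, h4⟩ := List.append_inj' h2 rfl
  simp only [List.cons.injEq, and_true] at h4
  subst h4 h1
  refine ⟨As, Q, Z1, h3, ?_, ?_⟩
  · rintro rfl
    simp only [blk_nil, List.append_nil, List.append_eq_nil_iff] at hXA
    exact hXA.2
  · rintro As' A rfl
    rw [List.nil_append, blk_append, blk_singleton] at hXA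
    rcases List.suffix_or_suffix_of_suffix (List.suffix_append X Z1)
      (hXA ▸ List.suffix_append (blk m As') (m :: A)) with hs | hs
    · rcases List.suffix_cons_iff.1 hs with rfl | hs
      · simp at hZ1
      · exact hs
    · exact absurd (hs.subset List.mem_cons_self) hZ1

lemma getElem?_append_rep {α : Type*} (A P : List α) (k i : ℕ) (h1 : A.length ≤ i)
    (h2 : i < A.length + k * P.length) :
    (A ++ rep (k + 1) P)[i]? = (A ++ rep (k + 1) P)[i + P.length]? := by
  have hl : (A ++ rep (k + 1) P)[i]? = (rep k P)[i - A.length]? := by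
    rw [rep_succ', List.getElem?_append_right h1, List.getElem?_append_left]
    rw [length_rep]; omega
  have hr : (A ++ rep (k + 1) P)[i + P.length]? = (rep k P)[i - A.length]? := by
    rw [rep_succ, ← List.append_assoc, List.getElem?_append_right (by simp; omega)]
    congr 1
    simp; omega
  rw [hl, hr]

/-! ### The words `Tv m v` and `Wv m y` -/

/-- The length of the `v`-th (counting from `0`) prefix of `A^(m+1)` of curling number at
most `m`. -/
noncomputable def Lv (m v : ℕ) : ℕ := Nat.nth (fun k => curl (gPrefix (m + 1) k) ≤ m) v

/-- The `v`-th (counting from `0`) prefix of `A^(m+1)` of curling number at most `m`. -/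
noncomputable def Tv (m v : ℕ) : List ℕ := gPrefix (m + 1) (Lv m v)

/-- The list of the first `y` factors between the occurrences of `m` in `A^(m)`. -/
noncomputable def Wl (m y : ℕ) : List (List ℕ) :=
  (List.range y).map fun x => Tv m (vl (m + 1) (x + 1))

/-- The prefix of `A^(m)` with `y` occurrences of `m` and curling number at most `m`. -/
noncomputable def Wv (m y : ℕ) : List ℕ := blk m (Wl m y)

/-- The length of `Wv m y`. -/
noncomputable def Fv (m y : ℕ) : ℕ := (Wv m y).length

@[simp] lemma length_Wl (m y : ℕ) : (Wl m y).length = y := by simp [Wl]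

@[simp] lemma length_Tv (m v : ℕ) : (Tv m v).length = Lv m v := length_gPrefix _ _

lemma notMem_Tv (m v : ℕ) : m ∉ Tv m v := notMem_gPrefix (Nat.lt_succ_self m)

lemma notMem_of_mem_Wl {m y : ℕ} {B : List ℕ} (h : B ∈ Wl m y) : m ∉ B := by
  simp only [Wl, List.mem_map] at h
  obtain ⟨x, -, rfl⟩ := h
  exact notMem_Tv _ _

lemma Wl_succ (m y : ℕ) : Wl m (y + 1) = Wl m y ++ [Tv m (vl (m + 1) (y + 1))] := by
  simp [Wl, List.range_succ]

lemma Wl_getElem? {m y i : ℕ} (h : i < y) : (Wl m y)[i]? = some (Tv m (vl (m + 1) (i + 1))) := by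
  simp [Wl, h]

lemma Wl_add {m c z : ℕ} (h : ∀ x, 0 < x → x ≤ z → vl (m + 1) (c + x) = vl (m + 1) x) :
    Wl m (c + z) = Wl m c ++ Wl m z := by
  induction z with
  | zero => simp [Wl]
  | succ z ih =>
    rw [← add_assoc, Wl_succ, Wl_succ, ih fun x h0 hx => h x h0 (by omega), add_assoc,
      h (z + 1) (by omega) le_rfl, List.append_assoc]

lemma Lv_zero {m : ℕ} (hm : 1 ≤ m) : Lv m 0 = 0 := by
  rw [Lv, Nat.nth_zero]
  refine Nat.le_zero.1 (Nat.sInf_le ?_)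
  show curl (gPrefix (m + 1) 0) ≤ m
  rw [gPrefix, curl_nil]; exact hm

lemma Tv_zero {m : ℕ} (hm : 1 ≤ m) : Tv m 0 = [] := by rw [Tv, Lv_zero hm]; rfl

lemma Lv_strictMono (hSH : StandingHyp) {m : ℕ} (hm : 1 ≤ m) : StrictMono (Lv m) :=
  Nat.nth_strictMono (hSH m hm).2

lemma curl_Tv_le (hSH : StandingHyp) {m : ℕ} (hm : 1 ≤ m) (v : ℕ) : curl (Tv m v) ≤ m :=
  Nat.nth_mem_of_infinite (hSH m hm).2 v

lemma exists_Lv_eq {m k : ℕ} (h : curl (gPrefix (m + 1) k) ≤ m) : ∃ v, Lv m v = k :=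
  ⟨_, Nat.nth_count h⟩

lemma Tv_injective (hSH : StandingHyp) {m : ℕ} (hm : 1 ≤ m) : Function.Injective (Tv m) :=
  (gPrefix_injective _).comp (Lv_strictMono hSH hm).injective

lemma Tv_prefix (hSH : StandingHyp) {m : ℕ} (hm : 1 ≤ m) {v w : ℕ} (h : v ≤ w) :
    Tv m v <+: Tv m w :=
  gPrefix_prefix _ ((Lv_strictMono hSH hm).monotone h)

lemma le_of_Tv_eq_append (hSH : StandingHyp) {m : ℕ} (hm : 1 ≤ m) {v w : ℕ} {Z : List ℕ}
    (h : Tv m w = Tv m v ++ Z) : v ≤ w := by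
  have := congrArg List.length h
  rw [List.length_append, length_Tv, length_Tv] at this
  exact (Lv_strictMono hSH hm).le_iff_le.1 (by omega)

/-! ### Repetitions in a word cut at the letter `m` -/

/-- The combinatorial shape of a repetition with period containing `m` at the end of
`blk m (Wl m y ++ [U])`; here `κ` is the number of occurrences of `m` in the period. -/
structure RepShape (m y k κ : ℕ) (U Z1 : List ℕ) : Prop where
  pos : 1 ≤ κ
  le : k * κ ≤ y + 1
  periodic : ∀ x, y + 1 < x + k * κ → x + κ < y + 1 → vl (m + 1) x = vl (m + 1) (x + κ)
  last : Tv m (vl (m + 1) (y + 1 - κ)) = U ++ Z1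
  nil : k * κ = y + 1 → Z1 = []
  suffix : k * κ < y + 1 → Z1 <:+ Tv m (vl (m + 1) (y + 1 - k * κ))

lemma exists_repShape (hSH : StandingHyp) {m y k : ℕ} (hm : 1 ≤ m) {U X Z : List ℕ} (hk : 2 ≤ k)
    (hU : m ∉ U) (hmZ : m ∈ Z) (h : blk m (Wl m y ++ [U]) = X ++ rep k Z) :
    ∃ κ Z1, RepShape m y k κ U Z1 := by
  obtain ⟨j, rfl⟩ : ∃ j, k = j + 2 := ⟨k - 2, by omega⟩
  obtain ⟨As, Q, Z1, hW, hnil, hsuf⟩ :=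
    blk_eq_append_rep (fun B hB => notMem_of_mem_Wl hB) hU hmZ h
  have hlen : y = As.length + ((j + 1) * (Q.length + 1) + Q.length) := by
    have := congrArg List.length hW
    simpa [length_Wl, add_assoc] using this
  have hW' : Wl m y ++ [U ++ Z1] = As ++ rep (j + 2) (Q ++ [U ++ Z1]) := by
    rw [hW, rep_succ' (j + 1)]; simp
  have hleft : ∀ i, i < y → (As ++ rep (j + 2) (Q ++ [U ++ Z1]))[i]?
      = some (Tv m (vl (m + 1) (i + 1))) := by
    intro i hi
    rw [← hW', List.getElem?_append_left (by simpa using hi), Wl_getElem? hi]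
  have hper := getElem?_append_rep As (Q ++ [U ++ Z1]) (j + 1)
  simp only [List.length_append, List.length_singleton] at hper
  have hmul : (j + 2) * (Q.length + 1) = (j + 1) * (Q.length + 1) + (Q.length + 1) := by ring
  refine ⟨Q.length + 1, Z1, by omega, by omega, ?_, ?_, ?_, ?_⟩
  · intro x h1 h2
    obtain ⟨i, rfl⟩ : ∃ i, x = i + 1 := ⟨x - 1, by omega⟩
    have := hper i (by omega) (by omega)
    rw [hleft i (by omega), hleft (i + (Q.length + 1)) (by omega)] at this
    have := Tv_injective hSH hm (Option.some_injective _ this)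
    rw [this]; congr 1; omega
  · have h3 : (1 : ℕ) * (Q.length + 1) ≤ (j + 1) * (Q.length + 1) :=
      Nat.mul_le_mul_right _ (by omega)
    have := hper (y - (Q.length + 1)) (by omega) (by omega)
    rw [hleft _ (by omega), ← hW', List.getElem?_append_right (by simp; omega)] at this
    have e : y - (Q.length + 1) + (Q.length + 1) - (Wl m y).length = 0 := by simp; omega
    have e2 : y - (Q.length + 1) + 1 = y + 1 - (Q.length + 1) := by omega
    rw [e, e2] at this
    simpa using this
  · intro h1
    exact hnil (List.length_eq_zero_iff.1 (by omega))
  · intro h1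
    obtain ⟨As', A, rfl⟩ := List.eq_nil_or_concat' As |>.resolve_left (by
      rintro rfl
      simp only [List.length_nil] at hlen
      omega)
    have hA : Tv m (vl (m + 1) (As'.length + 1)) = A := by
      have h2 := hleft As'.length (by rw [hlen]; simp; omega)
      rw [List.append_assoc, List.getElem?_append_right le_rfl] at h2
      simpa using h2.symm
    have e : y + 1 - (j + 2) * (Q.length + 1) = As'.length + 1 := by
      simp only [List.length_append, List.length_singleton] at hlen
      omega
    rw [e, hA]
    exact hsuf _ _ rfl

lemma exists_dvd_between {N : ℕ} (hN : 0 < N) (A : ℕ) : ∃ w, N ∣ w ∧ A ≤ w ∧ w < A + N := by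
  refine ⟨N * ((A + N - 1) / N), dvd_mul_right _ _, ?_, ?_⟩
  · have := Nat.div_add_mod (A + N - 1) N
    have := Nat.mod_lt (A + N - 1) hN
    omega
  · have := Nat.div_add_mod (A + N - 1) N
    omega

namespace RepShape

variable {m y k κ : ℕ} {U Z1 : List ℕ}

lemma pow_vl_dvd (h : RepShape m y k κ U Z1) (hm : 1 ≤ m) : (m + 1) ^ vl (m + 1) κ ∣ κ :=
  _root_.pow_vl_dvd (by omega) h.pos

lemma not_dvd (h : RepShape m y k κ U Z1) (hm : 1 ≤ m) : ¬ (m + 1) ^ (vl (m + 1) κ + 1) ∣ κ :=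
  not_pow_vl_succ_dvd (by omega) h.pos

/-- A multiple of a higher power of `m + 1` inside the repetition is only possible for squares,
at the boundary of the two periods. -/
lemma eq_of_dvd (h : RepShape m y k κ U Z1) (hm : 1 ≤ m) (hk : 2 ≤ k) {w : ℕ}
    (hw : (m + 1) ^ (vl (m + 1) κ + 1) ∣ w) (h1 : y + 1 < w + k * κ) (h2 : w < y + 1) :
    k = 2 ∧ w + κ = y + 1 := by
  have hb : 2 ≤ m + 1 := by omega
  have hκ := h.pos
  have hle := h.le
  have h3 : y + 1 ≤ w + κ := by
    by_contra hlt
    have h4 := h.periodic w h1 (by omega)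
    have h5 : 0 < w := by omega
    rw [pow_dvd_iff_le_vl hb h5, h4, ← pow_dvd_iff_le_vl hb (by omega)] at hw
    have h6 : (m + 1) ^ (vl (m + 1) κ + 1) ∣ w := by
      rw [pow_dvd_iff_le_vl hb h5, h4, ← pow_dvd_iff_le_vl hb (by omega)]; exact hw
    exact h.not_dvd hm ((Nat.dvd_add_right h6).1 hw)
  have h4 : w + (k - 1) * κ ≤ y + 1 := by
    obtain ⟨j, rfl⟩ : ∃ j, k = j + 2 := ⟨k - 2, by omega⟩
    have e1 : (j + 2) * κ = (j + 1) * κ + κ := by ring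
    have e2 : (j + 1) * κ = j * κ + κ := by ring
    simp only [show j + 2 - 1 = j + 1 from rfl]
    by_contra hlt
    have hwκ : κ < w := by omega
    obtain ⟨x, rfl⟩ : ∃ x, w = x + κ := ⟨w - κ, by omega⟩
    have h5 := h.periodic x (by omega) (by omega)
    have h6 : (m + 1) ^ (vl (m + 1) κ + 1) ∣ x := by
      rw [pow_dvd_iff_le_vl hb (by omega), h5, ← pow_dvd_iff_le_vl hb (by omega)]; exact hw
    exact h.not_dvd hm ((Nat.dvd_add_right h6).1 hw)
  obtain ⟨j, rfl⟩ : ∃ j, k = j + 2 := ⟨k - 2, by omega⟩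
  simp only [show j + 2 - 1 = j + 1 from rfl] at h4
  have e2 : (j + 1) * κ = j * κ + κ := by ring
  rcases Nat.eq_zero_or_pos j with rfl | hj
  · omega
  · have : κ ≤ j * κ := Nat.le_mul_of_pos_left _ hj
    omega

lemma le_succ (h : RepShape m y k κ U Z1) (hm : 1 ≤ m) (hk : 2 ≤ k) : k ≤ m + 1 := by
  by_contra hlt
  have hN : (m + 1) ^ (vl (m + 1) κ + 1) ≤ (m + 1) * κ := by
    rw [pow_succ']
    exact Nat.mul_le_mul_left _ (Nat.le_of_dvd h.pos (h.pow_vl_dvd hm))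
  have hkκ : (m + 2) * κ ≤ k * κ := Nat.mul_le_mul_right _ (by omega)
  have e : (m + 2) * κ = (m + 1) * κ + κ := by ring
  have hκ := h.pos
  have hle := h.le
  obtain ⟨w, hw, h1, h2⟩ := exists_dvd_between (N := (m + 1) ^ (vl (m + 1) κ + 1))
    (by positivity) (y + 1 - (m + 1) * κ)
  have := (h.eq_of_dvd hm hk hw (by omega) (by omega)).1
  omega

lemma not_dvd_of_eq_Tv (hSH : StandingHyp)
    (h : RepShape m y k κ (Tv m (vl (m + 1) (y + 1))) Z1) (hm : 1 ≤ m) (hk : 2 ≤ k) :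
    ¬ (m + 1) ^ (vl (m + 1) κ + 1) ∣ y + 1 := by
  intro hd
  have hκ := h.pos
  have hle := h.le
  have h2κ : 2 * κ ≤ k * κ := Nat.mul_le_mul_right _ hk
  have hv := le_of_Tv_eq_append hSH hm h.last
  obtain ⟨p, hp⟩ : ∃ p, y + 1 = p + κ := ⟨y + 1 - κ, by omega⟩
  rw [show y + 1 - κ = p by omega] at hv
  have h3 : (m + 1) ^ (vl (m + 1) κ + 1) ∣ p := by
    rw [pow_dvd_iff_le_vl (by omega) (by omega)] at hd ⊢; omega
  rw [hp] at hd
  exact h.not_dvd hm ((Nat.dvd_add_right h3).1 hd)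

lemma le_of_eq_Tv (hSH : StandingHyp) (h : RepShape m y k κ (Tv m (vl (m + 1) (y + 1))) Z1)
    (hm : 1 ≤ m) (hk : 2 ≤ k) : k ≤ m := by
  by_contra hlt
  have hb : 2 ≤ m + 1 := by omega
  have hκ := h.pos
  have hle := h.le
  have h2κ : 2 * κ ≤ k * κ := Nat.mul_le_mul_right _ hk
  obtain ⟨p, hp⟩ : ∃ p, y + 1 = p + κ := ⟨y + 1 - κ, by omega⟩
  have hp1 : y + 1 - κ = p := by omega
  have hnot := h.not_dvd_of_eq_Tv hSH hm hk
  have hN : (m + 1) ^ (vl (m + 1) κ + 1) ≤ (m + 1) * κ := by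
    rw [pow_succ']
    exact Nat.mul_le_mul_left _ (Nat.le_of_dvd h.pos (h.pow_vl_dvd hm))
  have hkκ : (m + 1) * κ ≤ k * κ := Nat.mul_le_mul_right _ (by omega)
  obtain ⟨w, hw, h1, h2⟩ := exists_dvd_between (N := (m + 1) ^ (vl (m + 1) κ + 1))
    (by positivity) (y + 1 - (m + 1) * κ + 1)
  have hwY : w ≠ y + 1 := fun h' => hnot (h' ▸ hw)
  obtain ⟨rfl, hwp⟩ := h.eq_of_dvd hm hk hw (by omega) (by omega)
  obtain rfl : m = 1 := by omega
  obtain rfl : w = p := by omega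
  have hYe : vl 2 (y + 1) = vl 2 κ := by
    refine vl_eq hb ?_ hnot
    rw [hp]
    exact dvd_add ((pow_dvd_pow _ (Nat.le_succ _)).trans hw) (h.pow_vl_dvd hm)
  have hpe : vl 2 κ + 1 ≤ vl 2 w := (pow_dvd_iff_le_vl hb (by omega) _).1 hw
  have hlast := h.last
  rw [hp1] at hlast
  simp only [Nat.reduceAdd] at hlast hw hnot
  rw [hYe] at hlast
  have hZ : Z1 ≠ [] := by
    rintro rfl
    rw [List.append_nil] at hlast
    have := Tv_injective hSH le_rfl hlast
    omega
  have hlt2 : 2 * κ < y + 1 := lt_of_le_of_ne hle fun h' => hZ (h.nil h')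
  obtain ⟨q, hq⟩ : ∃ q, w = q + κ := ⟨w - κ, by omega⟩
  have hqe : vl 2 q = vl 2 κ := by
    refine vl_eq hb ?_ ?_
    · have h3 : 2 ^ vl 2 κ ∣ q + κ := hq ▸ (pow_dvd_pow _ (Nat.le_succ _)).trans hw
      exact (Nat.dvd_add_left (h.pow_vl_dvd hm)).1 h3
    · intro h3
      rw [hq] at hw
      exact h.not_dvd hm ((Nat.dvd_add_right h3).1 hw)
  have hs := h.suffix hlt2
  simp only [Nat.reduceAdd] at hs
  rw [show y + 1 - 2 * κ = q by omega, hqe] at hs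
  obtain ⟨R, hR⟩ := hs
  have h2c : 2 ≤ curl (Tv 1 (vl 2 w)) := by
    refine le_curl (X := R) hZ ?_
    rw [hlast, ← hR]; simp [rep_succ]
  have := curl_Tv_le hSH (le_refl 1) (vl 2 w)
  omega

end RepShape

/-! ### The structure of `A^(m)` -/

lemma Wl_add_pow {m c e : ℕ} (hm : 1 ≤ m) (hc : (m + 1) ^ (e + 1) ∣ c) {z : ℕ}
    (hz : z < (m + 1) ^ (e + 1)) : Wl m (c + z) = Wl m c ++ Wl m z :=
  Wl_add fun _ h0 hx => vl_add (by omega) hc h0 (vl_lt (by omega) h0 (by omega))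

lemma Wl_mul_pow {m e i : ℕ} (hm : 1 ≤ m) (hi : i < m + 1) :
    Wl m (i * (m + 1) ^ e) = rep i (Wl m ((m + 1) ^ e)) := by
  have hb : 2 ≤ m + 1 := by omega
  induction i with
  | zero => simp [Wl]
  | succ i ih =>
    rw [rep_succ', ← ih (by omega), add_mul, one_mul]
    refine Wl_add fun x h0 hx => ?_
    rcases hx.lt_or_eq with hx | rfl
    · exact vl_add hb (dvd_mul_left _ _) h0 (vl_lt hb h0 hx)
    · rw [vl_pow hb, ← add_one_mul, mul_comm, vl_mul_pow hb (by omega),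
        vl_eq_zero hb (fun h => absurd (Nat.le_of_dvd (by omega) h) (by omega)), zero_add]

lemma Wl_pred_pow {m e : ℕ} (hm : 1 ≤ m) :
    Wl m ((m + 1) ^ e - 1) ++ [Tv m e] = Wl m ((m + 1) ^ e) := by
  have : 1 ≤ (m + 1) ^ e := Nat.one_le_pow _ _ (by omega)
  obtain ⟨z, hz⟩ : ∃ z, (m + 1) ^ e = z + 1 := ⟨(m + 1) ^ e - 1, by omega⟩
  rw [hz, Nat.add_sub_cancel, Wl_succ, ← hz, vl_pow (by omega)]

/-- Below a multiple of `(m+1)^(e+1)`, completing with `Tv m e` gives an `(m+1)`-st power. -/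
lemma Wl_concat_eq_rep {m c e : ℕ} (hm : 1 ≤ m) (hc : (m + 1) ^ (e + 1) ∣ c) :
    Wl m (c + (m * (m + 1) ^ e + ((m + 1) ^ e - 1))) ++ [Tv m e]
      = Wl m c ++ rep (m + 1) (Wl m ((m + 1) ^ e)) := by
  have h1 : 1 ≤ (m + 1) ^ e := Nat.one_le_pow _ _ (by omega)
  have hlt : m * (m + 1) ^ e + ((m + 1) ^ e - 1) < (m + 1) ^ (e + 1) := by
    rw [pow_succ', add_mul]; omega
  rw [Wl_add_pow hm hc hlt, rep_succ', List.append_assoc]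
  congr 1
  rw [← Wl_mul_pow hm (Nat.lt_succ_self m)]
  rw [← Wl_pred_pow (e := e) hm, ← List.append_assoc]
  congr 1
  exact Wl_add fun x h0 hx =>
    vl_add (by omega) (dvd_mul_left _ _) h0 (vl_lt (by omega) h0 (by omega))

lemma rep_suffix_of_notMem {m k : ℕ} {Ls : List (List ℕ)} {U X Z : List ℕ} (hmZ : m ∉ Z)
    (h : blk m (Ls ++ [U]) = X ++ rep k Z) : rep k Z <:+ U := by
  rw [blk_append, blk_singleton] at h
  rcases List.suffix_or_suffix_of_suffix (List.suffix_append X (rep k Z))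
      (h ▸ List.suffix_append (blk m Ls) (m :: U)) with hs | hs
  · rcases List.suffix_cons_iff.1 hs with h1 | h1
    · exact absurd (mem_rep (k := k) (Y := Z) (by rw [h1]; exact List.mem_cons_self)) hmZ
    · exact h1
  · exact absurd (mem_rep (hs.subset List.mem_cons_self)) hmZ

lemma le_curl_of_notMem {m k : ℕ} {Ls : List (List ℕ)} {U X Z : List ℕ} (hZ : Z ≠ [])
    (hmZ : m ∉ Z) (h : blk m (Ls ++ [U]) = X ++ rep k Z) : k ≤ curl U := by
  obtain ⟨R, hR⟩ := rep_suffix_of_notMem hmZ h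
  exact le_curl hZ hR.symm

lemma suffix_blk_concat (m : ℕ) (Ls : List (List ℕ)) (U : List ℕ) :
    U <:+ blk m (Ls ++ [U]) :=
  ⟨blk m Ls ++ [m], by simp⟩

lemma curl_blk_concat (hSH : StandingHyp) {m y i : ℕ} (hm : 1 ≤ m)
    (hi : i < Lv m (vl (m + 1) (y + 1))) :
    max m (curl (blk m (Wl m y ++ [gPrefix (m + 1) i])))
      = max (m + 1) (curl (gPrefix (m + 1) i)) := by
  have hU : m ∉ gPrefix (m + 1) i := notMem_gPrefix (Nat.lt_succ_self m)
  have hle : curl (blk m (Wl m y ++ [gPrefix (m + 1) i]))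
      ≤ max (m + 1) (curl (gPrefix (m + 1) i)) := by
    refine curl_le (le_max_of_le_left (by omega)) fun X Z k hZ h hk => ?_
    by_cases hmZ : m ∈ Z
    · obtain ⟨κ, Z1, hs⟩ := exists_repShape hSH hm hk hU hmZ h
      exact le_max_of_le_left (hs.le_succ hm hk)
    · exact le_max_of_le_right (le_curl_of_notMem hZ hmZ h)
  have hge : curl (gPrefix (m + 1) i) ≤ curl (blk m (Wl m y ++ [gPrefix (m + 1) i])) :=
    curl_le_of_suffix (suffix_blk_concat _ _ _)
  have hge2 : m + 1 ≤ curl (blk m (Wl m y ++ [gPrefix (m + 1) i])) := by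
    by_cases hc : curl (gPrefix (m + 1) i) ≤ m
    · obtain ⟨v, rfl⟩ := exists_Lv_eq hc
      have hv := (Lv_strictMono hSH hm).lt_iff_lt.1 hi
      obtain ⟨q, hq⟩ := (pow_dvd_iff_le_vl (b := m + 1) (by omega) (Nat.succ_pos y) (v + 1)).2 hv
      have h1 : 1 ≤ (m + 1) ^ v := Nat.one_le_pow _ _ (by omega)
      obtain ⟨q, rfl⟩ : ∃ r, q = r + 1 := ⟨q - 1, by
        rcases q with _ | q
        · simp at hq
        · rfl⟩
      have hy : y = (m + 1) ^ (v + 1) * q + (m * (m + 1) ^ v + ((m + 1) ^ v - 1)) := by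
        have e1 : (m + 1) ^ (v + 1) * (q + 1) =
          (m + 1) ^ (v + 1) * q + (m * (m + 1) ^ v + (m + 1) ^ v) := by ring
        omega
      have h2 := Wl_concat_eq_rep hm (dvd_mul_right ((m + 1) ^ (v + 1)) q)
      rw [← hy] at h2
      change m + 1 ≤ curl (blk m (Wl m y ++ [Tv m v]))
      rw [h2, blk_append, blk_rep]
      refine le_curl (fun h0 => ?_) rfl
      have h3 : (Wl m ((m + 1) ^ v)).length ≠ 0 := by simp
      cases hW : Wl m ((m + 1) ^ v) with
      | nil => rw [hW] at h3; simp at h3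
      | cons a l => rw [hW] at h0; simp at h0
    · omega
  omega

lemma gPrefix_mid_aux (hSH : StandingHyp) {m y : ℕ} (hm : 1 ≤ m)
    (hy : gPrefix m (Fv m y) = Wv m y) (hc : curl (Wv m y) ≤ m) {i : ℕ}
    (hi : i ≤ Lv m (vl (m + 1) (y + 1))) :
    gPrefix m (Fv m y + 1 + i) = blk m (Wl m y ++ [gPrefix (m + 1) i]) := by
  induction i with
  | zero =>
    rw [add_zero, show gPrefix m (Fv m y + 1) = gPrefix m (Fv m y) ++
      [max m (curl (gPrefix m (Fv m y)))] from rfl, hy, max_eq_left hc]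
    simp [gPrefix, Wv]
  | succ i ih =>
    rw [← add_assoc, gPrefix, ih (by omega), curl_blk_concat hSH hm hi]
    simp [gPrefix]

lemma Wv_succ (m y : ℕ) : Wv m (y + 1) = blk m (Wl m y ++ [Tv m (vl (m + 1) (y + 1))]) := by
  rw [Wv, Wl_succ]

lemma Fv_succ (m y : ℕ) : Fv m (y + 1) = Fv m y + 1 + Lv m (vl (m + 1) (y + 1)) := by
  rw [Fv, Wv_succ, blk_append, blk_singleton, List.length_append, List.length_cons, length_Tv,
    Fv, Wv]
  ring

@[simp] lemma Fv_zero (m : ℕ) : Fv m 0 = 0 := rfl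

lemma Fv_strictMono (m : ℕ) : StrictMono (Fv m) :=
  strictMono_nat_of_lt_succ fun y => by rw [Fv_succ]; omega

lemma curl_Wv_le (hSH : StandingHyp) {m : ℕ} (hm : 1 ≤ m) (y : ℕ) : curl (Wv m y) ≤ m := by
  cases y with
  | zero => rw [show Wv m 0 = [] from rfl, curl_nil]; exact hm
  | succ y =>
    rw [Wv_succ]
    refine curl_le hm fun X Z k hZ h hk => ?_
    by_cases hmZ : m ∈ Z
    · obtain ⟨κ, Z1, hs⟩ := exists_repShape hSH hm hk (notMem_Tv _ _) hmZ h
      exact hs.le_of_eq_Tv hSH hm hk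
    · exact (le_curl_of_notMem hZ hmZ h).trans (curl_Tv_le hSH hm _)

lemma gPrefix_Fv (hSH : StandingHyp) {m : ℕ} (hm : 1 ≤ m) (y : ℕ) :
    gPrefix m (Fv m y) = Wv m y := by
  induction y with
  | zero => rfl
  | succ y ih =>
    rw [Fv_succ, gPrefix_mid_aux hSH hm ih (curl_Wv_le hSH hm y) le_rfl, Wv_succ]
    rfl

lemma gPrefix_mid (hSH : StandingHyp) {m y : ℕ} (hm : 1 ≤ m) {i : ℕ}
    (hi : i ≤ Lv m (vl (m + 1) (y + 1))) :
    gPrefix m (Fv m y + 1 + i) = blk m (Wl m y ++ [gPrefix (m + 1) i]) :=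
  gPrefix_mid_aux hSH hm (gPrefix_Fv hSH hm y) (curl_Wv_le hSH hm y) hi

/-- Every position is either the end of a word `Wv m y` or inside a factor. -/
lemma exists_Fv_decomp (m k : ℕ) :
    (∃ y, k = Fv m y) ∨ ∃ y i, i < Lv m (vl (m + 1) (y + 1)) ∧ k = Fv m y + 1 + i := by
  induction k with
  | zero => exact Or.inl ⟨0, rfl⟩
  | succ k ih =>
    have key : ∀ y i, i ≤ Lv m (vl (m + 1) (y + 1)) →
        (∃ y', Fv m y + 1 + i = Fv m y') ∨
        ∃ y' i', i' < Lv m (vl (m + 1) (y' + 1)) ∧ Fv m y + 1 + i = Fv m y' + 1 + i' := by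
      intro y i hi
      rcases hi.lt_or_eq with h | h
      · exact Or.inr ⟨y, i, h, rfl⟩
      · exact Or.inl ⟨y + 1, by rw [Fv_succ, h]⟩
    rcases ih with ⟨y, rfl⟩ | ⟨y, i, hi, rfl⟩
    · exact key y 0 (Nat.zero_le _)
    · exact key y (i + 1) hi

lemma curl_gPrefix_le_iff (hSH : StandingHyp) {m : ℕ} (hm : 1 ≤ m) (k : ℕ) :
    curl (gPrefix m k) ≤ m ↔ ∃ y, k = Fv m y := by
  constructor
  · intro h
    rcases exists_Fv_decomp m k with h1 | ⟨y, i, hi, rfl⟩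
    · exact h1
    · exfalso
      rw [gPrefix_mid hSH hm hi.le] at h
      have := curl_blk_concat hSH hm hi
      have := le_max_left (m + 1) (curl (gPrefix (m + 1) i))
      omega
  · rintro ⟨y, rfl⟩
    rw [gPrefix_Fv hSH hm]; exact curl_Wv_le hSH hm y

/-- A strictly monotone enumeration of the naturals satisfying `p` is `Nat.nth p`. -/
lemma nth_eq_of_strictMono {p : ℕ → Prop} {f : ℕ → ℕ} (hf : StrictMono f)
    (h : ∀ k, p k ↔ ∃ x, k = f x) (x : ℕ) : Nat.nth p x = f x := by
  have h1 := Nat.nth_comp_of_strictMono (p := p) (n := x) hf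
    (fun k hk => by obtain ⟨x, rfl⟩ := (h k).1 hk; exact ⟨x, rfl⟩)
    (fun hfin => absurd hfin (by
      refine Set.not_finite.2 ?_ |> fun h => h
      refine Set.infinite_of_injective_forall_mem hf.injective fun x => (h _).2 ⟨x, rfl⟩))
  rw [← h1]
  congr 1
  have : (fun i => p (f i)) = fun _ => True := by
    funext i; exact eq_true ((h _).2 ⟨i, rfl⟩)
  rw [this, Nat.nth_true]

lemma piLen_eq (hSH : StandingHyp) {m : ℕ} (hm : 1 ≤ m) (x : ℕ) : piLen m x = Fv m x :=
  nth_eq_of_strictMono (Fv_strictMono m) (fun k => curl_gPrefix_le_iff hSH hm k) x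

/-! ### The digit map `chi` -/

section Chi

variable {b : ℕ}

@[simp] lemma chi_zero (b : ℕ) : chi b 0 = 0 := by simp [chi]

lemma chi_mul_add (hb : 2 ≤ b) (a : ℕ) {d : ℕ} (hd : d < b) :
    chi b (b * a + d) = (b + 1) * chi b a + d := by
  rcases Nat.eq_zero_or_pos (b * a + d) with h | h
  · have : d = 0 ∧ a = 0 := by
      refine ⟨by omega, ?_⟩
      rcases Nat.mul_eq_zero.1 (by omega : b * a = 0) with h | h <;> omega
    rw [this.1, this.2]; simp
  · rw [chi, Nat.digits_def' (by omega) h, Nat.ofDigits_cons, Nat.mul_add_mod, Nat.mod_eq_of_lt hd,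
      Nat.mul_add_div (by omega), Nat.div_eq_of_lt hd, add_zero, add_comm]
    rfl

lemma chi_of_lt (hb : 2 ≤ b) {d : ℕ} (hd : d < b) : chi b d = d := by
  simpa using chi_mul_add hb 0 hd

lemma chi_mul (hb : 2 ≤ b) (a : ℕ) : chi b (b * a) = (b + 1) * chi b a := by
  simpa using chi_mul_add hb a (by omega : 0 < b)

lemma chi_mul_pow_add (hb : 2 ≤ b) (c u : ℕ) {d : ℕ} (hd : d < b ^ u) :
    chi b (c * b ^ u + d) = chi b c * (b + 1) ^ u + chi b d := by
  induction u generalizing d with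
  | zero =>
    obtain rfl : d = 0 := by simpa using hd
    simp
  | succ u ih =>
    have h1 : d / b < b ^ u := Nat.div_lt_of_lt_mul (by rwa [pow_succ'] at hd)
    have h2 : d % b < b := Nat.mod_lt _ (by omega)
    have h3 : d = b * (d / b) + d % b := (Nat.div_add_mod d b).symm
    have h4 : c * b ^ (u + 1) + d = b * (c * b ^ u + d / b) + d % b := by
      conv_lhs => rw [h3]
      ring
    rw [h4, chi_mul_add hb _ h2, ih h1]
    conv_rhs => rw [h3, chi_mul_add hb _ h2]
    ring

lemma chi_mul_pow (hb : 2 ≤ b) (c u : ℕ) : chi b (c * b ^ u) = chi b c * (b + 1) ^ u := by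
  simpa using chi_mul_pow_add hb c u (d := 0) (by positivity)

lemma chi_pow (hb : 2 ≤ b) (u : ℕ) : chi b (b ^ u) = (b + 1) ^ u := by
  have := chi_mul_pow hb 1 u
  rwa [one_mul, chi_of_lt hb (by omega : 1 < b), one_mul] at this

lemma chi_lt_succ (hb : 2 ≤ b) (a : ℕ) : chi b a < chi b (a + 1) := by
  induction a using Nat.strong_induction_on with
  | _ a ih =>
    have h2 : a % b < b := Nat.mod_lt _ (by omega)
    have h3 : a = b * (a / b) + a % b := (Nat.div_add_mod a b).symm
    by_cases h : a % b + 1 < b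
    · have h4 : a + 1 = b * (a / b) + (a % b + 1) := by omega
      rw [h4, chi_mul_add hb _ h]
      conv_lhs => rw [h3, chi_mul_add hb _ h2]
      omega
    · have h4 : a + 1 = b * (a / b + 1) := by rw [mul_add]; omega
      have h5 : a / b < a := Nat.div_lt_self (by
        rcases Nat.eq_zero_or_pos a with rfl | ha
        · simp at h; omega
        · exact ha) (by omega)
      have h6 := Nat.mul_le_mul_left (b + 1) (ih _ h5)
      rw [h4, chi_mul hb]
      conv_lhs => rw [h3, chi_mul_add hb _ h2]
      have h7 : (b + 1) * (chi b (a / b)).succ = (b + 1) * chi b (a / b) + (b + 1) := by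
        rw [Nat.succ_eq_add_one]; ring
      omega

lemma chi_strictMono (hb : 2 ≤ b) : StrictMono (chi b) :=
  strictMono_nat_of_lt_succ (chi_lt_succ hb)

lemma chi_pos (hb : 2 ≤ b) {a : ℕ} (ha : 0 < a) : 0 < chi b a := by
  simpa using chi_strictMono hb ha

lemma chi_lt_pow (hb : 2 ≤ b) {u d : ℕ} (hd : d < b ^ u) : chi b d < (b + 1) ^ u := by
  rw [← chi_pow hb]; exact chi_strictMono hb hd

lemma chi_add_le (hb : 2 ≤ b) (a c : ℕ) : chi b a + chi b c ≤ chi b (a + c) := by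
  induction a using Nat.strong_induction_on generalizing c with
  | _ a ih =>
    rcases Nat.eq_zero_or_pos a with rfl | ha
    · simp
    have h2 : a % b < b := Nat.mod_lt _ (by omega)
    have h3 : a = b * (a / b) + a % b := (Nat.div_add_mod a b).symm
    have h2' : c % b < b := Nat.mod_lt _ (by omega)
    have h3' : c = b * (c / b) + c % b := (Nat.div_add_mod c b).symm
    have ih' := Nat.mul_le_mul_left (b + 1) (ih (a / b) (Nat.div_lt_self ha (by omega)) (c / b))
    rw [mul_add] at ih'
    have e1 : chi b a = (b + 1) * chi b (a / b) + a % b := by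
      conv_lhs => rw [h3]
      exact chi_mul_add hb _ h2
    have e2 : chi b c = (b + 1) * chi b (c / b) + c % b := by
      conv_lhs => rw [h3']
      exact chi_mul_add hb _ h2'
    by_cases h : a % b + c % b < b
    · have h4 : a + c = b * (a / b + c / b) + (a % b + c % b) := by rw [mul_add]; omega
      rw [h4, chi_mul_add hb _ h, e1, e2]
      omega
    · have h4 : a + c = b * (a / b + c / b + 1) + (a % b + c % b - b) := by
        rw [mul_add, mul_add]; omega
      have h5 := Nat.mul_le_mul_left (b + 1) (chi_lt_succ hb (a / b + c / b))
      have h6 : (b + 1) * (chi b (a / b + c / b)).succ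
        = (b + 1) * chi b (a / b + c / b) + (b + 1) := by rw [Nat.succ_eq_add_one]; ring
      rw [h4, chi_mul_add hb _ (by omega), e1, e2]
      omega

lemma vl_chi (hb : 2 ≤ b) {a : ℕ} (ha : 0 < a) : vl (b + 1) (chi b a) = vl b a := by
  induction a using Nat.strong_induction_on with
  | _ a ih =>
    have h2 : a % b < b := Nat.mod_lt _ (by omega)
    have h3 : a = b * (a / b) + a % b := (Nat.div_add_mod a b).symm
    rcases Nat.eq_zero_or_pos (a % b) with h | h
    · have h4 : a = b * (a / b) := by omega
      have h5 : 0 < a / b := Nat.pos_of_ne_zero fun h' => by rw [h'] at h4; omega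
      rw [h4, chi_mul hb, vl_mul_self (by omega) (chi_pos hb h5), vl_mul_self hb h5,
        ih _ (Nat.div_lt_self ha (by omega)) h5]
    · have h4 : chi b a = (b + 1) * chi b (a / b) + a % b := by
        conv_lhs => rw [h3]
        exact chi_mul_add hb _ h2
      rw [vl_eq_zero hb, vl_eq_zero (by omega)]
      · rw [h4, Nat.dvd_add_right (dvd_mul_right _ _)]
        exact fun h' => absurd (Nat.le_of_dvd h h') (by omega)
      · exact fun h' => by rw [Nat.dvd_iff_mod_eq_zero] at h'; omega

/-- No base-`(b+1)` digit of `chi b a` equals `b`. -/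
lemma chi_digit_ne (hb : 2 ≤ b) (a e : ℕ) : chi b a / (b + 1) ^ e % (b + 1) ≠ b := by
  have h1 : a % b ^ e < b ^ e := Nat.mod_lt _ (by positivity)
  have h2 : a = a / b ^ e * b ^ e + a % b ^ e := by rw [mul_comm, Nat.div_add_mod]
  rw [h2, chi_mul_pow_add hb _ _ h1, mul_comm, Nat.mul_add_div (by positivity),
    Nat.div_eq_of_lt (chi_lt_pow hb h1), add_zero]
  have h3 : a / b ^ e % b < b := Nat.mod_lt _ (by omega)
  rw [← Nat.div_add_mod (a / b ^ e) b, chi_mul_add hb _ h3, Nat.mul_add_mod,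
    Nat.mod_eq_of_lt (by omega)]
  omega

lemma exists_chi_eq (hb : 2 ≤ b) {y : ℕ} (hy : ∀ e, y / (b + 1) ^ e % (b + 1) ≠ b) :
    ∃ a, chi b a = y := by
  induction y using Nat.strong_induction_on with
  | _ y ih =>
    rcases Nat.eq_zero_or_pos y with rfl | hpos
    · exact ⟨0, chi_zero b⟩
    · obtain ⟨a, ha⟩ := ih (y / (b + 1)) (Nat.div_lt_self hpos (by omega)) fun e => by
        rw [Nat.div_div_eq_div_mul, ← pow_succ']; exact hy _
      have h0 := hy 0
      rw [pow_zero, Nat.div_one] at h0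
      have h1 : y % (b + 1) < b + 1 := Nat.mod_lt _ (by omega)
      refine ⟨b * a + y % (b + 1), ?_⟩
      rw [chi_mul_add hb _ (by omega), ha, Nat.div_add_mod]

lemma ofDigits_digits_chi (hb : 2 ≤ b) (a : ℕ) :
    Nat.ofDigits b (Nat.digits (b + 1) (chi b a)) = a := by
  rw [chi, Nat.digits_ofDigits (b + 1) (by omega), Nat.ofDigits_digits]
  · intro l hl
    have := Nat.digits_lt_base (by omega) hl
    omega
  · intro h
    exact Nat.getLast_digit_ne_zero b (by
      rintro rfl
      simp at h)

end Chi

/-! ### The sets enumerated by `iota` -/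

lemma Wl_prefix {m y z : ℕ} (h : y ≤ z) : Wl m y <+: Wl m z := by
  induction h with
  | refl => exact List.prefix_refl _
  | step _ ih => exact ih.trans (by rw [Wl_succ]; exact List.prefix_append _ _)

lemma Wv_ne_nil {m y : ℕ} (h : 0 < y) : Wv m y ≠ [] := by
  obtain ⟨z, rfl⟩ : ∃ z, y = z + 1 := ⟨y - 1, by omega⟩
  rw [Wv_succ]
  simp

lemma Wv_prefix {m y z : ℕ} (h : y ≤ z) : Wv m y <+: Wv m z := by
  obtain ⟨R, hR⟩ := Wl_prefix (m := m) h
  exact ⟨blk m R, by rw [Wv, Wv, ← hR, blk_append]⟩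

lemma Wv_add_pow {m C e r : ℕ} (hm : 1 ≤ m) (hr : r < (m + 1) ^ e) :
    Wv m (C * (m + 1) ^ e + r) = Wv m (C * (m + 1) ^ e) ++ Wv m r := by
  rw [Wv, Wl_add fun x h0 hx => vl_add (by omega) (dvd_mul_left _ _) h0
    (vl_lt (by omega) h0 (by omega)), blk_append]
  rfl

lemma le_curl_Wv_of_digit {m y e : ℕ} (hm : 1 ≤ m) (h : y / (m + 1) ^ e % (m + 1) = m) :
    m ≤ curl (Wv m y) := by
  have hr : y % (m + 1) ^ e < (m + 1) ^ e := Nat.mod_lt _ (by positivity)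
  have hy : y = y / (m + 1) ^ e / (m + 1) * (m + 1) ^ (e + 1)
      + (m * (m + 1) ^ e + y % (m + 1) ^ e) := by
    have h1 := Nat.div_add_mod y ((m + 1) ^ e)
    have h2 := Nat.div_add_mod (y / (m + 1) ^ e) (m + 1)
    rw [h] at h2
    conv_lhs => rw [← h1, ← h2]
    ring
  have hlt : m * (m + 1) ^ e + y % (m + 1) ^ e < (m + 1) ^ (e + 1) := by
    rw [pow_succ', add_mul]; omega
  obtain ⟨R, hR⟩ := Wv_prefix (m := m) hr.le
  have h3 : Wv m (m * (m + 1) ^ e) = rep m (Wv m ((m + 1) ^ e)) := by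
    rw [Wv, Wl_mul_pow hm (Nat.lt_succ_self m), blk_rep]; rfl
  have hW : Wv m y = Wv m (y / (m + 1) ^ e / (m + 1) * (m + 1) ^ (e + 1)) ++
      Wv m (y % (m + 1) ^ e) ++ rep m (R ++ Wv m (y % (m + 1) ^ e)) := by
    conv_lhs => rw [hy]
    rw [Wv_add_pow hm hlt, Wv_add_pow hm hr, h3, ← hR, rep_append_comm, List.append_assoc]
  refine le_curl (fun h0 => ?_) hW
  rw [List.append_eq_nil_iff] at h0
  exact Wv_ne_nil (m := m) (y := (m + 1) ^ e) (by positivity) (by rw [← hR, h0.1, h0.2]; rfl)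

/-- `Vp j a` says that the prefix of `A^(j+1)` with `chi (j+1) a` occurrences of `j+1` has
curling number at most `j`. -/
def Vp (j a : ℕ) : Prop := curl (Wv (j + 1) (chi (j + 1) a)) ≤ j

lemma curl_gPrefix_succ_le_iff (hSH : StandingHyp) {j : ℕ} (hj : 1 ≤ j) (k : ℕ) :
    curl (gPrefix (j + 1) k) ≤ j ↔ ∃ a, Vp j a ∧ k = Fv (j + 1) (chi (j + 1) a) := by
  constructor
  · intro h
    obtain ⟨y, rfl⟩ := (curl_gPrefix_le_iff hSH (by omega) k).1 (h.trans (Nat.le_succ j))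
    rw [gPrefix_Fv hSH (by omega)] at h
    obtain ⟨a, rfl⟩ := exists_chi_eq (b := j + 1) (y := y) (by omega) fun e he => by
      have := le_curl_Wv_of_digit (by omega) he
      omega
    exact ⟨a, h, rfl⟩
  · rintro ⟨a, ha, rfl⟩
    rw [gPrefix_Fv hSH (by omega)]; exact ha

/-- The increasing enumeration of `Vp j`. -/
noncomputable def av (j s : ℕ) : ℕ := Nat.nth (Vp j) s

lemma infinite_Vp (hSH : StandingHyp) {j : ℕ} (hj : 1 ≤ j) : {a | Vp j a}.Infinite := by
  intro hfin
  refine (hSH j hj).2 ((hfin.image fun a => Fv (j + 1) (chi (j + 1) a)).subset ?_)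
  intro k hk
  obtain ⟨a, ha, rfl⟩ := (curl_gPrefix_succ_le_iff hSH hj k).1 hk
  exact ⟨a, ha, rfl⟩

lemma av_strictMono (hSH : StandingHyp) {j : ℕ} (hj : 1 ≤ j) : StrictMono (av j) :=
  Nat.nth_strictMono (infinite_Vp hSH hj)

lemma Vp_av (hSH : StandingHyp) {j : ℕ} (hj : 1 ≤ j) (s : ℕ) : Vp j (av j s) :=
  Nat.nth_mem_of_infinite (infinite_Vp hSH hj) s

lemma av_count {j a : ℕ} (h : Vp j a) : av j (Nat.count (Vp j) a) = a := Nat.nth_count h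

lemma Lv_eq (hSH : StandingHyp) {j : ℕ} (hj : 1 ≤ j) (s : ℕ) :
    Lv j s = Fv (j + 1) (chi (j + 1) (av j s)) := by
  refine nth_eq_of_strictMono (f := fun s => Fv (j + 1) (chi (j + 1) (av j s)))
    ((Fv_strictMono _).comp ((chi_strictMono (by omega)).comp (av_strictMono hSH hj)))
    (fun k => ?_) s
  rw [curl_gPrefix_succ_le_iff hSH hj]
  constructor
  · rintro ⟨a, ha, rfl⟩
    exact ⟨Nat.count (Vp j) a, by rw [av_count ha]⟩
  · rintro ⟨s, rfl⟩
    exact ⟨_, Vp_av hSH hj s, rfl⟩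

lemma Tv_eq_Wv (hSH : StandingHyp) {j : ℕ} (hj : 1 ≤ j) (s : ℕ) :
    Tv j s = Wv (j + 1) (chi (j + 1) (av j s)) := by
  rw [Tv, Lv_eq hSH hj, gPrefix_Fv hSH (by omega)]

lemma count_Wv (m y : ℕ) : (Wv m y).count m = y := by
  induction y with
  | zero => rfl
  | succ y ih =>
    rw [Wv_succ, blk_append, blk_singleton, List.count_append, List.count_cons_self,
      List.count_eq_zero_of_not_mem (notMem_Tv _ _)]
    change (Wv m y).count m + 1 = _
    rw [ih]

lemma iota_succ (hSH : StandingHyp) {j : ℕ} (hj : 1 ≤ j) (s : ℕ) : iota j (s + 1) = av j s := by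
  rw [iota, show Tstr j (s + 1) = Tv j s from rfl, Tv_eq_Wv hSH hj, count_Wv]
  exact ofDigits_digits_chi (by omega) _

/-! ### A criterion for the curling number of `Wv m y` to be at least `m` -/

/-- The exceptional configuration producing a square at the end of `Wv m y`. -/
def Exc (m y : ℕ) : Prop :=
  (m + 1) ^ vl (m + 1) y < y ∧ vl (m + 1) y < vl (m + 1) (y - (m + 1) ^ vl (m + 1) y) ∧
    ∃ Z, Z ≠ [] ∧ Z <:+ Tv m (vl (m + 1) y) ∧
      Tv m (vl (m + 1) (y - (m + 1) ^ vl (m + 1) y)) = Tv m (vl (m + 1) y) ++ Z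

lemma le_curl_Tv_or_exc (hSH : StandingHyp) {m y : ℕ} (hm : 2 ≤ m) (hy : 0 < y)
    (hd : ∀ e, y / (m + 1) ^ e % (m + 1) ≠ m) (h : m ≤ curl (Wv m y)) :
    m ≤ curl (Tv m (vl (m + 1) y)) ∨ (m = 2 ∧ Exc m y) := by
  have hb : 2 ≤ m + 1 := by omega
  obtain ⟨y, rfl⟩ : ∃ z, y = z + 1 := ⟨y - 1, by omega⟩
  obtain ⟨X, Z, hZ, hW⟩ := exists_rep_of_le_curl hm h
  rw [Wv_succ] at hW
  by_cases hmZ : m ∈ Z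
  swap
  · exact Or.inl (le_curl_of_notMem hZ hmZ hW)
  right
  obtain ⟨κ, Z1, hs⟩ := exists_repShape hSH (by omega) hm (notMem_Tv _ _) hmZ hW
  have hκ := hs.pos
  have hle := hs.le
  have h2κ : 2 * κ ≤ m * κ := Nat.mul_le_mul_right _ hm
  have hnot := hs.not_dvd_of_eq_Tv hSH (by omega) hm
  have hdvd := hs.pow_vl_dvd (by omega)
  have hndvd := hs.not_dvd (by omega)
  set e := vl (m + 1) κ with he
  have hpos : 0 < (m + 1) ^ e := by positivity
  have hmod := Nat.div_add_mod (y + 1) ((m + 1) ^ (e + 1))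
  have hmodlt := Nat.mod_lt (y + 1) (show 0 < (m + 1) ^ (e + 1) by positivity)
  have hdig : (y + 1) % (m + 1) ^ (e + 1) / (m + 1) ^ e ≠ m := by
    rw [pow_succ, Nat.mod_mul_right_div_self]; exact hd e
  have hle_m : (y + 1) % (m + 1) ^ (e + 1) / (m + 1) ^ e < m + 1 :=
    Nat.div_lt_of_lt_mul (by rwa [← pow_succ])
  have hlt_m : (y + 1) % (m + 1) ^ (e + 1) < m * (m + 1) ^ e :=
    (Nat.div_lt_iff_lt_mul hpos).1 (by omega)
  have hmκ : m * (m + 1) ^ e ≤ m * κ := Nat.mul_le_mul_left _ (Nat.le_of_dvd hκ hdvd)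
  have hr0 : (y + 1) % (m + 1) ^ (e + 1) ≠ 0 := fun h0 => hnot (Nat.dvd_of_mod_eq_zero h0)
  obtain ⟨rfl, hw⟩ := hs.eq_of_dvd (by omega) hm
    (w := (m + 1) ^ (e + 1) * ((y + 1) / (m + 1) ^ (e + 1)))
    (dvd_mul_right _ _) (by omega) (by omega)
  refine ⟨rfl, ?_⟩
  simp only [Nat.reduceAdd] at *
  have hκr : (y + 1) % 3 ^ (e + 1) = κ := by omega
  have hκe : κ = 3 ^ e := by
    obtain ⟨d, hd'⟩ := hdvd
    have : d < 2 := by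
      by_contra hlt
      have : 3 ^ e * 2 ≤ 3 ^ e * d := Nat.mul_le_mul_left _ (by omega)
      omega
    have : d ≠ 0 := by rintro rfl; simp at hd'; omega
    obtain rfl : d = 1 := by omega
    rw [hd', mul_one]
  have hYe : vl 3 (y + 1) = e := by
    refine vl_eq hb ?_ hnot
    rw [← hw]
    exact dvd_add ((pow_dvd_pow _ (Nat.le_succ _)).trans (dvd_mul_right _ _))
      (hκe ▸ dvd_rfl)
  have hp : y + 1 - 3 ^ e = 3 ^ (e + 1) * ((y + 1) / 3 ^ (e + 1)) := by omega
  have hpe : e + 1 ≤ vl 3 (y + 1 - 3 ^ e) := by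
    rw [← pow_dvd_iff_le_vl hb (by omega), hp]
    exact dvd_mul_right _ _
  have hlast := hs.last
  simp only [Nat.reduceAdd] at hlast
  rw [hYe, hκe] at hlast
  have hZ1 : Z1 ≠ [] := by
    rintro rfl
    rw [List.append_nil] at hlast
    have := Tv_injective hSH (by omega) hlast
    omega
  have hlt : 2 * κ < y + 1 := lt_of_le_of_ne hle fun h' => hZ1 (hs.nil h')
  have hsuf := hs.suffix hlt
  simp only [Nat.reduceAdd] at hsuf
  have hq : vl 3 (y + 1 - 2 * κ) = e := by
    have h1 : y + 1 - 3 ^ e = (y + 1 - 2 * κ) + κ := by omega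
    refine vl_eq hb ?_ fun h3 => ?_
    · refine (Nat.dvd_add_left (hκe ▸ dvd_rfl : 3 ^ e ∣ κ)).1 ?_
      rw [← h1, hp]
      exact (pow_dvd_pow _ (Nat.le_succ _)).trans (dvd_mul_right _ _)
    · refine hndvd ((Nat.dvd_add_right h3).1 ?_)
      rw [← h1, hp]
      exact dvd_mul_right _ _
  rw [hq] at hsuf
  rw [Exc]
  simp only [Nat.reduceAdd]
  rw [hYe]
  exact ⟨by omega, by omega, Z1, hZ1, hsuf, hlast⟩

lemma Tv_suffix_Wv {m y : ℕ} (hy : 0 < y) : Tv m (vl (m + 1) y) <:+ Wv m y := by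
  obtain ⟨y, rfl⟩ : ∃ z, y = z + 1 := ⟨y - 1, by omega⟩
  rw [Wv_succ]
  exact suffix_blk_concat _ _ _

lemma Wv_pow (m : ℕ) {e : ℕ} (hm : 1 ≤ m) :
    Wv m ((m + 1) ^ e) = blk m (Wl m ((m + 1) ^ e - 1)) ++ m :: Tv m e := by
  rw [Wv, ← Wl_pred_pow hm]; simp

lemma two_le_curl_of_exc {m y : ℕ} (hm : 1 ≤ m) (h : Exc m y) : 2 ≤ curl (Wv m y) := by
  have hb : 2 ≤ m + 1 := by omega
  obtain ⟨h1, h2, Z, hZ, hsuf, hT⟩ := h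
  have hy : 0 < y := by omega
  set e := vl (m + 1) y with he
  have hpos : 0 < (m + 1) ^ e := by positivity
  obtain ⟨w, hw⟩ : ∃ w, y = w + (m + 1) ^ e := ⟨y - (m + 1) ^ e, by omega⟩
  have hwe : y - (m + 1) ^ e = w := by omega
  rw [hwe] at h2 hT
  have hwpos : 0 < w := by omega
  obtain ⟨c, hc⟩ := (pow_dvd_iff_le_vl hb hwpos (e + 1)).2 h2
  have hc0 : c ≠ 0 := by rintro rfl; omega
  obtain ⟨c, rfl⟩ : ∃ d, c = d + 1 := ⟨c - 1, by omega⟩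
  -- `w = p + (m + 1) ^ e` with `vl p = e`
  obtain ⟨p, hp, hpe, hppos⟩ : ∃ p, w = p + (m + 1) ^ e ∧ vl (m + 1) p = e ∧ 0 < p := by
    have e1 : w = (m + 1) ^ e * ((m + 1) * c + m) + (m + 1) ^ e := by rw [hc]; ring
    refine ⟨_, e1, ?_, by positivity⟩
    rw [vl_mul_pow hb (by positivity), vl_eq_zero hb, zero_add]
    rw [Nat.dvd_add_right (dvd_mul_right _ _)]
    exact fun h' => absurd (Nat.le_of_dvd (by omega) h') (by omega)
  have hdvdp : (m + 1) ^ e ∣ p := hpe ▸ pow_vl_dvd hb hppos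
  have hWy : Wv m y = Wv m w ++ Wv m ((m + 1) ^ e) := by
    rw [hw, Wv, Wl_add_pow hm ⟨_, hc⟩ (Nat.pow_lt_pow_right (by omega) (Nat.lt_succ_self e)),
      blk_append]
    rfl
  have hWw : Wv m w = Wv m p ++ Wv m ((m + 1) ^ e) ++ Z := by
    obtain ⟨z, hz⟩ : ∃ z, (m + 1) ^ e = z + 1 := ⟨(m + 1) ^ e - 1, by omega⟩
    have hwz : w = (p + z) + 1 := by omega
    rw [Wv_pow m hm, hz, Nat.add_sub_cancel]
    nth_rw 1 [hwz]
    rw [Wv_succ, ← hwz, hT, Wl_add fun x h0 hx =>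
      vl_add hb hdvdp h0 (vl_lt hb h0 (by omega))]
    simp [Wv]
  obtain ⟨R, hR⟩ := (hsuf.trans (hpe ▸ Tv_suffix_Wv hppos) : Z <:+ Wv m p)
  refine le_curl (X := R) (Y := Z ++ Wv m ((m + 1) ^ e)) (by simp [hZ]) ?_
  rw [hWy, hWw, ← hR]
  simp [rep_succ]

/-! ### Shifting by a level at which a new letter appears -/

/-- `Tv m u` ends with the first occurrence of `n`. -/
def EndsFirst (n m u : ℕ) : Prop := ∃ P, Tv m u = P ++ [n] ∧ n ∉ P

namespace EndsFirst

variable {n m u : ℕ}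

lemma mem (h : EndsFirst n m u) : n ∈ Tv m u := by
  obtain ⟨P, hP, -⟩ := h
  rw [hP]; simp

lemma lt (h : EndsFirst n m u) : m < n := le_of_mem_gPrefix h.mem

lemma notMem_of_lt (hSH : StandingHyp) (hm : 1 ≤ m) (h : EndsFirst n m u) {v : ℕ} (hv : v < u) :
    n ∉ Tv m v := by
  obtain ⟨P, hP, hn⟩ := h
  have h1 := Tv_prefix hSH hm hv.le
  have hlt := Lv_strictMono hSH hm hv
  have hl := congrArg List.length hP
  rw [length_Tv, List.length_append, List.length_singleton] at hl
  rw [hP] at h1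
  have h2 := List.prefix_of_prefix_length_le h1 (List.prefix_append P [n])
    (by rw [length_Tv]; omega)
  exact fun h' => hn (h2.subset h')

lemma curl_eq (h : EndsFirst n m u) : curl (Tv m u) = 1 := by
  obtain ⟨P, hP, hn⟩ := h
  rw [hP]; exact curl_concat_of_notMem hn

lemma Wv_pow_eq (hSH : StandingHyp) (hm : 1 ≤ m) (h : EndsFirst n m u) :
    ∃ P, Wv m ((m + 1) ^ u) = P ++ [n] ∧ n ∉ P := by
  have h0 := h
  have hmn := h.lt
  obtain ⟨P, hP, hn⟩ := h
  refine ⟨blk m (Wl m ((m + 1) ^ u - 1)) ++ m :: P, ?_, ?_⟩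
  · rw [Wv_pow m hm, hP]; simp
  · have h1 : n ∉ blk m (Wl m ((m + 1) ^ u - 1)) := by
      simp only [blk, List.mem_flatMap, List.mem_cons, not_exists, not_and, not_or]
      intro B hB
      refine ⟨by omega, ?_⟩
      simp only [Wl, List.mem_map, List.mem_range] at hB
      obtain ⟨x, hx, rfl⟩ := hB
      exact h0.notMem_of_lt hSH hm (vl_lt (by omega) (by omega) (by omega))
    simp only [List.mem_append, List.mem_cons, not_or]
    exact ⟨h1, by omega, hn⟩

end EndsFirst

/-- The word `P ++ [n, a]`, where `n` is new and different from `a`, has curling number one. -/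
lemma curl_concat_concat {P : List ℕ} {n a : ℕ} (hn : n ∉ P) (ha : n ≠ a) :
    curl (P ++ [n] ++ [a]) = 1 := by
  refine le_antisymm (curl_le le_rfl fun X Z k hZ h hk => ?_) (one_le_curl _)
  exfalso
  obtain ⟨j, rfl⟩ : ∃ j, k = j + 2 := ⟨k - 2, by omega⟩
  have hlen : 1 ≤ Z.length := List.length_pos_iff.2 hZ
  have hnZ : n ∉ Z := by
    intro hz
    have h1 := congrArg (List.count n) h
    rw [rep_succ, rep_succ] at h1
    have h2 := List.count_pos_iff.2 hz
    simp only [List.count_append, List.count_eq_zero_of_not_mem hn, List.count_singleton] at h1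
    simp [Ne.symm ha] at h1
    omega
  have h1 : rep (j + 2) Z <:+ P ++ n :: [a] := ⟨X, by rw [← h]; simp⟩
  rcases List.suffix_or_suffix_of_suffix h1 (List.suffix_append P (n :: [a])) with hs | hs
  · rcases List.suffix_cons_iff.1 hs with h2 | h2
    · exact hnZ (mem_rep (k := j + 2) (by rw [h2]; simp))
    · have := h2.length_le
      rw [length_rep] at this
      simp only [List.length_singleton] at this
      nlinarith
  · exact hnZ (mem_rep (hs.subset List.mem_cons_self))

section Shift

variable {n j u : ℕ}

lemma Vp_of_shift {c d : ℕ} (hj : 1 ≤ j) (hd : d < (j + 1) ^ u)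
    (h : Vp j (c * (j + 1) ^ u + d)) : Vp j d := by
  rw [Vp, chi_mul_pow_add (by omega) _ _ hd, Wv_add_pow (by omega) (chi_lt_pow (by omega) hd)] at h
  exact (curl_le_of_suffix (List.suffix_append _ _)).trans h

lemma Vp_zero (hj : 1 ≤ j) : Vp j 0 := by
  rw [Vp, chi_zero]
  exact curl_nil.le.trans hj

lemma Vp_shift (hSH : StandingHyp) {c d : ℕ} (hj : 1 ≤ j) (h : EndsFirst n (j + 1) u)
    (hd0 : 0 < d) (hd : d < (j + 1) ^ u) (hV : Vp j d) : Vp j (c * (j + 1) ^ u + d) := by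
  by_contra hV'
  rw [Vp] at hV hV'
  have hb : 2 ≤ j + 1 := by omega
  have hb' : 2 ≤ j + 1 + 1 := by omega
  have hpos := chi_pos hb hd0
  have hlt := chi_lt_pow hb hd
  have hvl : vl (j + 1 + 1) (chi (j + 1) (c * (j + 1) ^ u + d))
      = vl (j + 1 + 1) (chi (j + 1) d) := by
    rw [chi_mul_pow_add hb _ _ hd]
    exact vl_add hb' (dvd_mul_left _ _) hpos (vl_lt hb' hpos hlt)
  have hvu : vl (j + 1 + 1) (chi (j + 1) d) < u := vl_lt hb' hpos hlt
  rcases le_curl_Tv_or_exc hSH hb (chi_pos hb (by omega)) (chi_digit_ne hb _)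
    (by omega : j + 1 ≤ curl (Wv (j + 1) (chi (j + 1) (c * (j + 1) ^ u + d)))) with h1 | ⟨h2, h3⟩
  · rw [hvl] at h1
    have := curl_le_of_suffix (Tv_suffix_Wv (m := j + 1) hpos)
    omega
  · rw [Exc, hvl] at h3
    set e := vl (j + 1 + 1) (chi (j + 1) d) with he
    obtain ⟨h4, h5, Z, hZ, hsuf, hT⟩ := h3
    rw [chi_mul_pow_add hb _ _ hd] at h4 h5 hT
    have hdvd : (j + 1 + 1) ^ e ∣ chi (j + 1) d := pow_vl_dvd hb' hpos
    have hle := Nat.le_of_dvd hpos hdvd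
    rw [Nat.add_sub_assoc hle] at h5 hT
    rcases hle.lt_or_eq with hlt' | heq
    · have h6 : vl (j + 1 + 1) (chi (j + 1) c * (j + 1 + 1) ^ u
          + (chi (j + 1) d - (j + 1 + 1) ^ e))
          = vl (j + 1 + 1) (chi (j + 1) d - (j + 1 + 1) ^ e) :=
        vl_add hb' (dvd_mul_left _ _) (by omega) (vl_lt hb' (by omega) (by omega))
      rw [h6] at h5 hT
      have h7 : Exc (j + 1) (chi (j + 1) d) := by
        rw [Exc, ← he]
        exact ⟨hlt', h5, Z, hZ, hsuf, hT⟩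
      have := two_le_curl_of_exc (by omega) h7
      omega
    · rw [heq, Nat.sub_self, add_zero] at h5 hT
      have hc : 0 < chi (j + 1) c * (j + 1 + 1) ^ u := by omega
      have h6 : u ≤ vl (j + 1 + 1) (chi (j + 1) c * (j + 1 + 1) ^ u) :=
        (pow_dvd_iff_le_vl hb' hc u).1 (dvd_mul_left _ _)
      have h7 : n ∈ Tv (j + 1) (vl (j + 1 + 1) (chi (j + 1) c * (j + 1 + 1) ^ u)) :=
        (Tv_prefix hSH (by omega) h6).subset h.mem
      have hnot := h.notMem_of_lt hSH (by omega) hvu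
      rw [hT, List.mem_append] at h7
      rcases h7 with h7 | h7
      · exact hnot h7
      · exact hnot (hsuf.subset h7)

lemma Vp_pow (hSH : StandingHyp) (hj : 1 ≤ j) (h : EndsFirst n (j + 1) u) :
    Vp j ((j + 1) ^ u) := by
  obtain ⟨P, hP, hn⟩ := h.Wv_pow_eq hSH (by omega)
  rw [Vp, chi_pow (by omega), hP, curl_concat_of_notMem hn]
  exact hj

/-- The appearance of `n` at level `j` is governed by its appearance at level `j + 1`. -/
lemma EndsFirst.step (hSH : StandingHyp) (hj : 1 ≤ j) (h : EndsFirst n (j + 1) u) :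
    EndsFirst n j (Nat.count (Vp j) ((j + 1) ^ u)) := by
  rw [EndsFirst, Tv_eq_Wv hSH hj, av_count (Vp_pow hSH hj h), chi_pow (by omega)]
  exact h.Wv_pow_eq hSH (by omega)

lemma Lv_succ_of_endsFirst (hSH : StandingHyp) {m : ℕ} (hm : 1 ≤ m) (h : EndsFirst n m u)
    (hn : m + 1 < n) : Tv m (u + 1) = Tv m u ++ [m + 1] := by
  have h1 : gPrefix (m + 1) (Lv m u + 1) = Tv m u ++ [m + 1] := by
    rw [gPrefix]
    change Tv m u ++ [max (m + 1) (curl (Tv m u))] = _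
    rw [h.curl_eq, max_eq_left (by omega)]
  have h2 : curl (gPrefix (m + 1) (Lv m u + 1)) ≤ m := by
    obtain ⟨P, hP, hnP⟩ := h
    rw [h1, hP, curl_concat_concat hnP (by omega)]
    exact hm
  obtain ⟨v, hv⟩ := exists_Lv_eq h2
  have hmono := Lv_strictMono hSH hm
  have h3 : u + 1 ≤ v := hmono.lt_iff_lt.1 (by omega)
  have h4 := hmono.monotone h3
  have h5 := hmono (Nat.lt_succ_self u)
  rw [Tv, show Lv m (u + 1) = Lv m u + 1 by rw [Nat.succ_eq_add_one] at h5; omega, h1]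

/-- Certain multiples of `(j+1)^u` belong to `Vp j`. -/
lemma Vp_mul_pow (hSH : StandingHyp) (hj : 1 ≤ j) (h : EndsFirst n (j + 1) u) (hn : 3 < n)
    (q : ℕ) : Vp j (((j + 1) ^ 2 * q + (j + 1) + 1) * (j + 1) ^ u) := by
  by_contra hV'
  rw [Vp] at hV'
  have hb : 2 ≤ j + 1 := by omega
  have hb' : 2 ≤ j + 1 + 1 := by omega
  set c := (j + 1) ^ 2 * q + (j + 1) + 1 with hc
  have hchi : chi (j + 1) c = (j + 1 + 1) * ((j + 1 + 1) * chi (j + 1) q + 1) + 1 := by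
    rw [show c = (j + 1) * ((j + 1) * q + 1) + 1 by rw [hc]; ring, chi_mul_add hb _ (by omega),
      chi_mul_add hb _ (by omega)]
  have hy : chi (j + 1) (c * (j + 1) ^ u) = (j + 1 + 1) ^ u * chi (j + 1) c := by
    rw [chi_mul_pow hb, mul_comm]
  have hvl : vl (j + 1 + 1) (chi (j + 1) (c * (j + 1) ^ u)) = u := by
    rw [hy, vl_mul_pow hb' (by omega), vl_eq_zero hb', zero_add]
    rw [hchi, Nat.dvd_add_right (dvd_mul_right _ _)]
    exact fun h' => absurd (Nat.le_of_dvd (by omega) h') (by omega)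
  have hpos : 0 < c * (j + 1) ^ u := by positivity
  rcases le_curl_Tv_or_exc hSH hb (chi_pos hb hpos) (chi_digit_ne hb _)
    (by omega : j + 1 ≤ curl (Wv (j + 1) (chi (j + 1) (c * (j + 1) ^ u)))) with h1 | ⟨h2, h3⟩
  · rw [hvl, h.curl_eq] at h1
    omega
  · rw [Exc, hvl] at h3
    obtain ⟨-, -, Z, hZ, hsuf, hT⟩ := h3
    have hsub : chi (j + 1) (c * (j + 1) ^ u) - (j + 1 + 1) ^ u
        = (j + 1 + 1) ^ u * ((j + 1 + 1) * ((j + 1 + 1) * chi (j + 1) q + 1)) := by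
      rw [hy, hchi, mul_add, mul_one, Nat.add_sub_cancel]
    have hv1 : vl (j + 1 + 1) (chi (j + 1) (c * (j + 1) ^ u) - (j + 1 + 1) ^ u) = u + 1 := by
      rw [hsub, vl_mul_pow hb' (by positivity), vl_mul_self hb' (by omega), vl_eq_zero hb']
      · ring
      · rw [Nat.dvd_add_right (dvd_mul_right _ _)]
        exact fun h' => absurd (Nat.le_of_dvd (by omega) h') (by omega)
    rw [hv1, Lv_succ_of_endsFirst hSH (by omega) h (by omega)] at hT
    have hZ' := List.append_cancel_left hT
    obtain ⟨P, hP, -⟩ := h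
    rw [← hZ', hP] at hsuf
    obtain ⟨R, hR⟩ := hsuf
    have h4 := (List.append_inj' hR rfl).2
    simp only [List.cons.injEq, and_true] at h4
    omega

end Shift

/-! ### Counting elements of `Vp j` -/

lemma Vp_of_not_dvd (hSH : StandingHyp) {j a : ℕ} (hj : 1 ≤ j) (h : ¬ (j + 1) ∣ a) : Vp j a := by
  by_contra hV
  rw [Vp] at hV
  have hb : 2 ≤ j + 1 := by omega
  have ha : 0 < a := Nat.pos_of_ne_zero fun h0 => h (h0 ▸ dvd_zero _)
  have hvl : vl (j + 1 + 1) (chi (j + 1) a) = 0 := by rw [vl_chi hb ha, vl_eq_zero hb h]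
  rcases le_curl_Tv_or_exc hSH hb (chi_pos hb ha) (chi_digit_ne hb _)
    (by omega : j + 1 ≤ curl (Wv (j + 1) (chi (j + 1) a))) with h1 | ⟨-, -, -, Z, hZ, hs, -⟩
  · rw [hvl, Tv_zero (by omega), curl_nil] at h1; omega
  · rw [hvl, Tv_zero (by omega)] at hs
    exact hZ (List.suffix_nil.1 hs)

section Count

variable {n j u : ℕ}

lemma count_shift (hSH : StandingHyp) (hj : 1 ≤ j) (h : EndsFirst n (j + 1) u) (c : ℕ) {x : ℕ}
    (hx0 : 1 ≤ x) (hx : x ≤ (j + 1) ^ u) :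
    Nat.count (Vp j) (c * (j + 1) ^ u + x) + 1
      = Nat.count (Vp j) (c * (j + 1) ^ u) + (if Vp j (c * (j + 1) ^ u) then 1 else 0)
        + Nat.count (Vp j) x := by
  obtain ⟨z, rfl⟩ : ∃ z, x = z + 1 := ⟨x - 1, by omega⟩
  clear hx0
  induction z with
  | zero =>
    rw [zero_add, Nat.count_succ, Nat.count_succ (Vp j) 0, if_pos (Vp_zero hj), Nat.count_zero]
  | succ z ih =>
    have h1 : Vp j (c * (j + 1) ^ u + (z + 1)) ↔ Vp j (z + 1) :=
      ⟨Vp_of_shift hj (by omega), Vp_shift hSH hj h (by omega) (by omega)⟩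
    have := ih (by omega)
    rw [← add_assoc, Nat.count_succ, Nat.count_succ (Vp j) (z + 1)]
    simp only [add_assoc, h1] at this ⊢
    omega

lemma count_succ_mul (hSH : StandingHyp) (hj : 1 ≤ j) (h : EndsFirst n (j + 1) u) (c : ℕ) :
    Nat.count (Vp j) ((c + 1) * (j + 1) ^ u) + 1
      = Nat.count (Vp j) (c * (j + 1) ^ u) + (if Vp j (c * (j + 1) ^ u) then 1 else 0)
        + Nat.count (Vp j) ((j + 1) ^ u) := by
  rw [add_mul, one_mul]
  exact count_shift hSH hj h c (Nat.one_le_pow _ _ (by omega)) le_rfl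

lemma one_le_count (hj : 1 ≤ j) {x : ℕ} (hx : 1 ≤ x) : 1 ≤ Nat.count (Vp j) x :=
  (by rw [Nat.count_succ, if_pos (Vp_zero hj)]; omega : 1 ≤ Nat.count (Vp j) (0 + 1)).trans
    (Nat.count_monotone _ hx)

lemma count_mul_le (hSH : StandingHyp) (hj : 1 ≤ j) (h : EndsFirst n (j + 1) u) (c : ℕ) :
    Nat.count (Vp j) (c * (j + 1) ^ u) ≤ c * Nat.count (Vp j) ((j + 1) ^ u) := by
  induction c with
  | zero => simp
  | succ c ih =>
    have := count_succ_mul hSH hj h c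
    rw [add_mul c 1 (Nat.count _ _)]
    split_ifs at this <;> omega

lemma le_count_add_mul (hSH : StandingHyp) (hj : 1 ≤ j) (h : EndsFirst n (j + 1) u) (c d : ℕ) :
    Nat.count (Vp j) (c * (j + 1) ^ u) + d * (Nat.count (Vp j) ((j + 1) ^ u) - 1)
      ≤ Nat.count (Vp j) ((c + d) * (j + 1) ^ u) := by
  induction d with
  | zero => simp
  | succ d ih =>
    have h1 := count_succ_mul hSH hj h (c + d)
    have h2 := one_le_count hj (Nat.one_le_pow u (j + 1) (by omega))
    rw [← add_assoc, add_mul d 1 (_ - 1)]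
    omega

lemma le_count_sq_mul (hSH : StandingHyp) (hj : 1 ≤ j) (h : EndsFirst n (j + 1) u) (hn : 3 < n)
    (q : ℕ) :
    q * ((j + 1) ^ 2 * (Nat.count (Vp j) ((j + 1) ^ u) - 1) + 1)
      ≤ Nat.count (Vp j) (((j + 1) ^ 2 * q) * (j + 1) ^ u) := by
  induction q with
  | zero => simp
  | succ q ih =>
    have h1 := le_count_add_mul hSH hj h ((j + 1) ^ 2 * q) (j + 1 + 1)
    have h2 := count_succ_mul hSH hj h ((j + 1) ^ 2 * q + (j + 1 + 1))
    rw [← add_assoc] at h1 h2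
    rw [if_pos (Vp_mul_pow hSH hj h hn q)] at h2
    obtain ⟨r, hr⟩ : ∃ r, (j + 1) ^ 2 = j + 1 + 1 + 1 + r := by
      refine ⟨(j + 1) ^ 2 - (j + 1 + 1 + 1), ?_⟩
      have : j + 1 + 1 + 1 ≤ (j + 1) ^ 2 := by nlinarith
      omega
    have h3 := le_count_add_mul hSH hj h ((j + 1) ^ 2 * q + (j + 1) + 1 + 1) r
    have e1 : (j + 1) ^ 2 * q + (j + 1) + 1 + 1 + r = (j + 1) ^ 2 * (q + 1) := by
      rw [mul_add, mul_one]; omega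
    rw [e1] at h3
    have h4 := one_le_count hj (Nat.one_le_pow u (j + 1) (by omega))
    set t := Nat.count (Vp j) ((j + 1) ^ u)
    have e2 : (q + 1) * ((j + 1) ^ 2 * (t - 1) + 1)
        = q * ((j + 1) ^ 2 * (t - 1) + 1) + ((j + 1 + 1) * (t - 1) + (t - 1) + r * (t - 1) + 1) := by
      rw [add_mul, one_mul]
      nth_rw 2 [hr]
      ring
    rw [e2]
    omega

/-- The limiting density of `iota j` determines the count of `Vp j` up to `(j+1)^u`. -/
lemma ceil_mul_eq_count (hSH : StandingHyp) (hj : 1 ≤ j) (h : EndsFirst n (j + 1) u) (hn : 3 < n)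
    {r : ℝ} (hr : Tendsto (fun x : ℕ => (x : ℝ) / (iota j x : ℝ)) atTop (nhds r)) :
    ⌈r * ((j : ℝ) + 1) ^ u⌉₊ = Nat.count (Vp j) ((j + 1) ^ u) := by
  have ht1 := one_le_count hj (Nat.one_le_pow u (j + 1) (by omega))
  have hlow := le_count_sq_mul hSH hj h hn
  have hup := count_mul_le hSH hj h
  have hav := av_strictMono hSH hj
  set t := Nat.count (Vp j) ((j + 1) ^ u) with ht
  set M := (j + 1) ^ u with hM
  have hMpos : 0 < M := by positivity
  have hMR : ((j : ℝ) + 1) ^ u = (M : ℝ) := by rw [hM]; push_cast; ring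
  have hMposR : (0 : ℝ) < M := by exact_mod_cast hMpos
  set N := (j + 1) ^ 2 with hN
  have hNpos : 0 < N := by positivity
  have hNposR : (0 : ℝ) < N := by exact_mod_cast hNpos
  have hge : ∀ q, q ≤ Nat.count (Vp j) (N * q * M) := fun q =>
    (Nat.le_mul_of_pos_right q (Nat.succ_pos _)).trans (hlow q)
  have htend : Tendsto (fun q => Nat.count (Vp j) (N * q * M)) atTop atTop :=
    tendsto_atTop_mono hge tendsto_id
  have hupper : r * M ≤ t := by
    have h1 : Tendsto (fun q : ℕ => ((Nat.count (Vp j) (N * q * M) + 1 : ℕ) : ℝ)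
        / (iota j (Nat.count (Vp j) (N * q * M) + 1) : ℝ)) atTop (nhds r) :=
      hr.comp (tendsto_atTop_mono (fun _ => Nat.le_succ _) htend)
    have h2 : Tendsto (fun q : ℕ => (t : ℝ) / M + 1 / (N * M) * (1 / (q : ℝ))) atTop
        (nhds ((t : ℝ) / M + 1 / (N * M) * 0)) :=
      tendsto_const_nhds.add (tendsto_const_nhds.mul tendsto_one_div_atTop_nhds_zero_nat)
    have h3 : r ≤ (t : ℝ) / M + 1 / (N * M) * 0 := by
      refine le_of_tendsto_of_tendsto h1 h2 ?_
      filter_upwards [eventually_ge_atTop 1] with q hq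
      have hqR : (0 : ℝ) < q := by exact_mod_cast hq
      rw [iota_succ hSH hj]
      have h4 : N * q * M ≤ av j (Nat.count (Vp j) (N * q * M)) :=
        Nat.le_nth_count (infinite_Vp hSH hj) _
      have h5 : ((N * q * M : ℕ) : ℝ) ≤ (av j (Nat.count (Vp j) (N * q * M)) : ℝ) := by
        exact_mod_cast h4
      have h6 : ((Nat.count (Vp j) (N * q * M) + 1 : ℕ) : ℝ) ≤ ((N * q * t + 1 : ℕ) : ℝ) := by
        exact_mod_cast Nat.succ_le_succ (hup (N * q))
      push_cast at h5 h6 ⊢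
      calc _ ≤ ((N : ℝ) * q * t + 1) / (N * q * M) := by
            apply div_le_div₀ (by positivity) h6 (by positivity) h5
        _ = _ := by field_simp
    rw [mul_zero, add_zero, le_div_iff₀ hMposR] at h3
    exact h3
  have hlower : (t : ℝ) - 1 < r * M := by
    have h1 : Tendsto (fun q : ℕ => ((Nat.count (Vp j) (N * q * M) : ℕ) : ℝ)
        / (iota j (Nat.count (Vp j) (N * q * M)) : ℝ)) atTop (nhds r) := hr.comp htend
    have h3 : ((N : ℝ) * (t - 1) + 1) / (N * M) ≤ r := by
      refine ge_of_tendsto h1 ?_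
      filter_upwards [eventually_ge_atTop 2] with q hq
      have hqR : (0 : ℝ) < q := by exact_mod_cast (by omega : 0 < q)
      have hgq := hge q
      obtain ⟨s, hs⟩ : ∃ s, Nat.count (Vp j) (N * q * M) = s + 1 :=
        ⟨Nat.count (Vp j) (N * q * M) - 1, by omega⟩
      have h4 : av j s < N * q * M := Nat.nth_lt_of_lt_count (by omega)
      have h5 : s ≤ av j s := hav.le_apply
      have h6 : (0 : ℝ) < av j s := by exact_mod_cast (by omega : 0 < av j s)
      have h7 : (av j s : ℝ) ≤ ((N * q * M : ℕ) : ℝ) := by exact_mod_cast h4.le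
      have h8 : ((q * (N * (t - 1) + 1) : ℕ) : ℝ) ≤ ((s + 1 : ℕ) : ℝ) := by
        exact_mod_cast hs ▸ hlow q
      rw [hs, iota_succ hSH hj]
      rw [Nat.cast_mul, Nat.cast_add, Nat.cast_mul, Nat.cast_sub ht1] at h8
      push_cast at h7 h8 ⊢
      calc ((N : ℝ) * (t - 1) + 1) / (N * M) = (q * (N * (t - 1) + 1)) / (N * q * M) := by
            field_simp
        _ ≤ _ := by apply div_le_div₀ (by positivity) h8 h6 h7
    rw [div_le_iff₀ (by positivity)] at h3
    nlinarith
  rw [hMR, Nat.ceil_eq_iff (by omega)]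
  rw [Nat.cast_sub ht1]
  exact ⟨by simpa using hlower, hupper⟩

end Count

/-! ### The first occurrence of a letter -/

lemma endsFirst_one (hSH : StandingHyp) {m : ℕ} (hm : 1 ≤ m) : EndsFirst (m + 1) m 1 := by
  have h1 : gPrefix (m + 1) 1 = [m + 1] := by
    simp [gPrefix, curl_nil]
  have h2 : curl (gPrefix (m + 1) 1) ≤ m := by
    rw [h1]
    exact (curl_concat_of_notMem (P := []) (n := m + 1) (by simp)).le.trans hm
  obtain ⟨v, hv⟩ := exists_Lv_eq h2
  have hmono := Lv_strictMono hSH hm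
  have h0 := Lv_zero hm
  have h3 : 1 ≤ v := Nat.one_le_iff_ne_zero.2 (by rintro rfl; omega)
  have h4 := hmono.monotone h3
  have h5 := hmono Nat.zero_lt_one
  refine ⟨[], ?_, by simp⟩
  rw [Tv, show Lv m 1 = 1 by omega, h1]
  rfl

lemma gPrefix_eq_append_gij (m : ℕ) {p : ℕ} (hp : 1 ≤ p) :
    gPrefix m p = gPrefix m (p - 1) ++ [gij m p] := by
  obtain ⟨q, rfl⟩ : ∃ q, p = q + 1 := ⟨p - 1, by omega⟩
  rfl

lemma EndsFirst.phi_eq (hSH : StandingHyp) {m n t : ℕ} (hm : 1 ≤ m) (h : EndsFirst n m t) :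
    phi m n = Fv m ((m + 1) ^ t) := by
  obtain ⟨P, hP, hn⟩ := h.Wv_pow_eq hSH hm
  have hg := gPrefix_Fv hSH hm ((m + 1) ^ t)
  rw [hP] at hg
  have hlen : Fv m ((m + 1) ^ t) = P.length + 1 := by rw [Fv, hP]; simp
  refine le_antisymm (Nat.sInf_le ⟨by omega, ?_⟩) (le_csInf ?_ ?_)
  · rw [gPrefix_eq_append_gij m (by omega)] at hg
    simpa using (List.append_inj' hg rfl).2
  · refine ⟨Fv m ((m + 1) ^ t), by omega, ?_⟩
    rw [gPrefix_eq_append_gij m (by omega)] at hg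
    simpa using (List.append_inj' hg rfl).2
  · rintro p ⟨hp1, hp⟩
    by_contra hlt
    have h1 : gPrefix m p <+: P ++ [n] := hg ▸ gPrefix_prefix m (by omega)
    have h2 := List.prefix_of_prefix_length_le h1 (List.prefix_append P [n])
      (by rw [length_gPrefix]; omega)
    refine hn (h2.subset ?_)
    rw [gPrefix_eq_append_gij m hp1, hp]
    simp

/-! ### Sums over the values of a multiplicity -/

/-- The sum of `g (vl b x)` over `1 ≤ x ≤ y`. -/
noncomputable def vsum (b : ℕ) (g : ℕ → ℕ) (y : ℕ) : ℕ := ∑ x ∈ Finset.range y, g (vl b (x + 1))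

lemma vsum_succ (b : ℕ) (g : ℕ → ℕ) (y : ℕ) :
    vsum b g (y + 1) = vsum b g y + g (vl b (y + 1)) := Finset.sum_range_succ _ _

@[simp] lemma vsum_zero (b : ℕ) (g : ℕ → ℕ) : vsum b g 0 = 0 := rfl

lemma vsum_eq {b : ℕ} (hb : 2 ≤ b) (g : ℕ → ℕ) (y : ℕ) :
    vsum b g y = (y - y / b) * g 0 + vsum b (fun v => g (v + 1)) (y / b) := by
  induction y with
  | zero => simp
  | succ y ih =>
    have hle : y / b ≤ y := Nat.div_le_self _ _
    rw [vsum_succ, ih, Nat.succ_div]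
    split_ifs with h
    · obtain ⟨c, hc⟩ := h
      have h0 : 0 < c := Nat.pos_of_ne_zero (by rintro rfl; simp at hc)
      have h1 : c = y / b + 1 := by
        have := Nat.succ_div_of_dvd (a := y) (b := b) ⟨c, hc⟩
        rw [hc, Nat.mul_div_cancel_left _ (by omega)] at this
        exact this
      have h2 : vl b (y + 1) = vl b c + 1 := by rw [hc, vl_mul_self hb h0]
      rw [vsum_succ, ← h1, h2, show y + 1 - c = y - y / b by omega]
      ring
    · rw [vl_eq_zero hb h, add_zero, Nat.sub_add_comm hle]
      ring

lemma vsum_add_le {b : ℕ} (hb : 2 ≤ b) (g : ℕ → ℕ) (hg : Monotone g) (x y : ℕ) :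
    vsum b g x + vsum b g y ≤ vsum b g (x + y) := by
  induction x using Nat.strong_induction_on generalizing y g with
  | _ x ih =>
    rcases Nat.eq_zero_or_pos x with rfl | hx
    · simp
    have hg' : Monotone fun v => g (v + 1) := fun _ _ h => hg (Nat.succ_le_succ h)
    have h0 := ih (x / b) (Nat.div_lt_self hx (by omega)) _ hg' (y / b)
    have hxl : x / b ≤ x := Nat.div_le_self _ _
    have hyl : y / b ≤ y := Nat.div_le_self _ _
    have hxyl : (x + y) / b ≤ x + y := Nat.div_le_self _ _
    rw [vsum_eq hb g x, vsum_eq hb g y, vsum_eq hb g (x + y)]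
    rw [Nat.add_div (by omega)] at hxyl ⊢
    have e1 : (x - x / b) * g 0 + (y - y / b) * g 0 = (x + y - (x / b + y / b)) * g 0 := by
      rw [← add_mul]; congr 1; omega
    split_ifs at hxyl ⊢ with hc
    · have h1 : g 0 ≤ g (vl b (x / b + y / b + 1) + 1) := hg (Nat.zero_le _)
      have e2 : (x + y - (x / b + y / b)) * g 0
          = (x + y - (x / b + y / b + 1)) * g 0 + g 0 := by
        rw [← add_one_mul]; congr 1; omega
      rw [vsum_succ]
      omega
    · rw [add_zero]
      omega

lemma Fv_eq (m y : ℕ) : Fv m y = y + vsum (m + 1) (Lv m) y := by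
  induction y with
  | zero => rfl
  | succ y ih => rw [Fv_succ, vsum_succ, ih]; ring

lemma Fv_add_le (hSH : StandingHyp) {m : ℕ} (hm : 1 ≤ m) (x y : ℕ) :
    Fv m x + Fv m y ≤ Fv m (x + y) := by
  have := vsum_add_le (b := m + 1) (by omega) _ (Lv_strictMono hSH hm).monotone x y
  rw [Fv_eq, Fv_eq, Fv_eq]; omega

lemma Fv_add_of_vl {m c z : ℕ} (h : ∀ x, 0 < x → x ≤ z → vl (m + 1) (c + x) = vl (m + 1) x) :
    Fv m (c + z) = Fv m c + Fv m z := by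
  rw [Fv, Wv, Wl_add h, blk_append, List.length_append]
  rfl

lemma Fv_pow_add {m u z : ℕ} (hm : 1 ≤ m) (hz : z < (m + 1) ^ u) :
    Fv m ((m + 1) ^ u + z) = Fv m ((m + 1) ^ u) + Fv m z :=
  Fv_add_of_vl fun _ h0 hx => vl_add (by omega) dvd_rfl h0 (vl_lt (by omega) h0 (by omega))

lemma Fv_mul_pow {m e i : ℕ} (hm : 1 ≤ m) (hi : i < m + 1) :
    Fv m (i * (m + 1) ^ e) = i * Fv m ((m + 1) ^ e) := by
  rw [Fv, Wv, Wl_mul_pow hm hi, blk_rep, length_rep]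
  rfl

lemma Fv_pow_succ {m : ℕ} (hm : 1 ≤ m) (s : ℕ) :
    Fv m ((m + 1) ^ (s + 1)) + Lv m s = (m + 1) * Fv m ((m + 1) ^ s) + Lv m (s + 1) := by
  have hb : 2 ≤ m + 1 := by omega
  obtain ⟨z, hz⟩ : ∃ z, (m + 1) ^ s = z + 1 :=
    ⟨(m + 1) ^ s - 1, by have := Nat.one_le_pow s (m + 1) (by omega); omega⟩
  have h1 : (m + 1) ^ (s + 1) = m * (m + 1) ^ s + z + 1 := by rw [pow_succ', add_mul]; omega
  have h2 : Fv m (m * (m + 1) ^ s + z) = Fv m (m * (m + 1) ^ s) + Fv m z :=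
    Fv_add_of_vl fun _ h0 hx => vl_add hb (dvd_mul_left _ _) h0 (vl_lt hb h0 (by omega))
  have h3 := Fv_succ m (m * (m + 1) ^ s + z)
  have h4 := Fv_succ m z
  rw [← h1, vl_pow hb, h2, Fv_mul_pow hm (by omega)] at h3
  rw [← hz, vl_pow hb] at h4
  rw [h3, add_mul]
  omega

/-! ### Superadditivity of `Lv` at a special level -/

section Shift

variable {n m u : ℕ}

lemma count_pow_add_le (hSH : StandingHyp) (hm : 1 ≤ m) (h : EndsFirst n (m + 1) u) (x : ℕ) :
    Nat.count (Vp m) ((m + 1) ^ u + x)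
      ≤ Nat.count (Vp m) ((m + 1) ^ u) + Nat.count (Vp m) x := by
  rcases Nat.eq_zero_or_pos x with rfl | hx
  · simp
  have hM : 0 < (m + 1) ^ u := by positivity
  obtain ⟨c, d, rfl, hd0, hd⟩ : ∃ c d, x = c * (m + 1) ^ u + d ∧ 1 ≤ d ∧ d ≤ (m + 1) ^ u := by
    refine ⟨(x - 1) / (m + 1) ^ u, (x - 1) % (m + 1) ^ u + 1, ?_, Nat.le_add_left _ _,
      Nat.mod_lt _ hM⟩
    have := Nat.div_add_mod (x - 1) ((m + 1) ^ u)
    rw [mul_comm] at this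
    omega
  have h1 := count_shift hSH hm h c hd0 hd
  have h2 := count_shift hSH hm h (c + 1) hd0 hd
  have h3 := count_succ_mul hSH hm h c
  have e1 : (m + 1) ^ u + (c * (m + 1) ^ u + d) = (c + 1) * (m + 1) ^ u + d := by ring
  rw [e1]
  split_ifs at h1 h2 h3 <;> omega

lemma le_av_add (hSH : StandingHyp) (hm : 1 ≤ m) (h : EndsFirst n (m + 1) u) (s : ℕ) :
    (m + 1) ^ u + av m s ≤ av m (Nat.count (Vp m) ((m + 1) ^ u) + s) := by
  rw [av, av, ← Nat.count_le_iff_le_nth (infinite_Vp hSH hm)]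
  refine (count_pow_add_le hSH hm h _).trans ?_
  rw [Nat.count_nth_of_infinite (infinite_Vp hSH hm)]

lemma av_add_eq (hSH : StandingHyp) (hm : 1 ≤ m) (h : EndsFirst n (m + 1) u) {s : ℕ}
    (hs : s < Nat.count (Vp m) ((m + 1) ^ u)) :
    av m s < (m + 1) ^ u ∧
      av m (Nat.count (Vp m) ((m + 1) ^ u) + s) = (m + 1) ^ u + av m s := by
  have hlt : av m s < (m + 1) ^ u := Nat.nth_lt_of_lt_count hs
  refine ⟨hlt, ?_⟩
  have hM := Vp_pow hSH hm h
  rcases Nat.eq_zero_or_pos s with rfl | hs0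
  · have : av m 0 = 0 := by
      have := av_count (Vp_zero hm)
      rwa [Nat.count_zero] at this
    rw [this, add_zero, add_zero, av_count hM]
  · have hpos : 0 < av m s := lt_of_lt_of_le hs0 (av_strictMono hSH hm).le_apply
    have h1 := Vp_shift hSH (c := 1) hm h hpos hlt (Vp_av hSH hm s)
    have h2 := count_shift hSH hm h 1 hpos hlt.le
    rw [one_mul] at h1 h2
    rw [if_pos hM, av, Nat.count_nth_of_infinite (infinite_Vp hSH hm)] at h2
    have h3 := av_count h1
    rwa [show Nat.count (Vp m) ((m + 1) ^ u + av m s) = Nat.count (Vp m) ((m + 1) ^ u) + s by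
      rw [av]; omega] at h3

lemma Lv_count_pow (hSH : StandingHyp) (hm : 1 ≤ m) (h : EndsFirst n (m + 1) u) :
    Lv m (Nat.count (Vp m) ((m + 1) ^ u)) = Fv (m + 1) ((m + 1 + 1) ^ u) := by
  rw [Lv_eq hSH hm, av_count (Vp_pow hSH hm h), chi_pow (by omega)]

lemma Lv_add_le (hSH : StandingHyp) (hm : 1 ≤ m) (h : EndsFirst n (m + 1) u) (s : ℕ) :
    Lv m (Nat.count (Vp m) ((m + 1) ^ u)) + Lv m s
      ≤ Lv m (Nat.count (Vp m) ((m + 1) ^ u) + s) := by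
  rw [Lv_count_pow hSH hm h, Lv_eq hSH hm s, Lv_eq hSH hm (_ + s)]
  refine (Fv_add_le hSH (by omega) _ _).trans ((Fv_strictMono _).monotone ?_)
  rw [← chi_pow (by omega)]
  exact (chi_add_le (by omega) _ _).trans
    ((chi_strictMono (by omega)).monotone (le_av_add hSH hm h s))

lemma Lv_add_eq (hSH : StandingHyp) (hm : 1 ≤ m) (h : EndsFirst n (m + 1) u) {s : ℕ}
    (hs : s < Nat.count (Vp m) ((m + 1) ^ u)) :
    Lv m (Nat.count (Vp m) ((m + 1) ^ u) + s)
      = Lv m (Nat.count (Vp m) ((m + 1) ^ u)) + Lv m s := by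
  obtain ⟨hlt, he⟩ := av_add_eq hSH hm h hs
  have h1 := chi_mul_pow_add (b := m + 1) (by omega) 1 u hlt
  rw [chi_of_lt (by omega) (by omega : 1 < m + 1), one_mul, one_mul] at h1
  rw [Lv_count_pow hSH hm h, Lv_eq hSH hm s, Lv_eq hSH hm (_ + s), he, h1,
    Fv_pow_add (by omega) (chi_lt_pow (by omega) hlt)]

end Shift

/-! ### Estimates for the limiting constant -/

/-- An affine recursion with superadditive increments. -/
structure AffineRec (b t : ℕ) (f L : ℕ → ℝ) : Prop where
  hb : 2 ≤ b
  zero : f 0 = 1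
  L_zero : L 0 = 0
  pos : 0 < f t
  succ (s : ℕ) : f (s + 1) = b * f s + L (s + 1) - L s
  add_le (s : ℕ) : L t + L s ≤ L (t + s)
  add_eq {s : ℕ} (hs : s < t) : L (t + s) = L t + L s
  le (s : ℕ) : (b : ℝ) ^ s ≤ f s

namespace AffineRec

variable {b t : ℕ} {f L : ℕ → ℝ} {ε : ℝ}

lemma le_add (h : AffineRec b t f L) (s : ℕ) :
    L (t + s) - L t - L s ≤ f (t + s) - b ^ s * f t - f s + b ^ s := by
  induction s with
  | zero => simp [h.zero, h.L_zero]
  | succ s ih =>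
    have hb : (2 : ℝ) ≤ b := by exact_mod_cast h.hb
    have h1 := h.add_le s
    have h2 := h.succ s
    have h3 := h.succ (t + s)
    rw [← add_assoc, h2, h3, pow_succ]
    nlinarith

lemma add_eq' (h : AffineRec b t f L) {s : ℕ} (hs : s ≤ t) :
    f (t + s) - b ^ s * f t - f s + b ^ s = L (t + s) - L t - L s := by
  induction s with
  | zero => simp [h.zero, h.L_zero]
  | succ s ih =>
    have h1 := h.add_eq hs
    have h2 := h.succ s
    have h3 := h.succ (t + s)
    have h4 := ih (by omega)
    rw [← add_assoc, h2, h3, pow_succ]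
    rw [h1] at h4 ⊢
    linear_combination (b : ℝ) * h4

lemma lower (h : AffineRec b t f L)
    (hε : Tendsto (fun s => f s / (b : ℝ) ^ s) atTop (nhds ε)) :
    f t ≤ 1 - ε + ε * b ^ t := by
  have hb : (0 : ℝ) < b := by exact_mod_cast (by have := h.hb; omega : 0 < b)
  have h1 : Tendsto (fun s => f (t + s) / (b : ℝ) ^ (t + s) * b ^ t - f s / (b : ℝ) ^ s) atTop
      (nhds (ε * b ^ t - ε)) := by
    refine Tendsto.sub (Tendsto.mul_const _ ?_) hε
    have := hε.comp (tendsto_add_atTop_nat t)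
    simpa [Function.comp_def, add_comm] using this
  have h2 : f t - 1 ≤ ε * b ^ t - ε := by
    refine ge_of_tendsto' h1 fun s => ?_
    have h3 := h.le_add s
    have h4 := h.add_le s
    have h5 : f (t + s) / (b : ℝ) ^ (t + s) * b ^ t - f s / (b : ℝ) ^ s
        = (f (t + s) - f s) / b ^ s := by
      rw [pow_add]; field_simp
    rw [h5, le_div_iff₀ (by positivity)]
    linarith
  linarith

lemma one_le (h : AffineRec b t f L)
    (hε : Tendsto (fun s => f s / (b : ℝ) ^ s) atTop (nhds ε)) : 1 ≤ ε := by
  have hb : (0 : ℝ) < b := by exact_mod_cast (by have := h.hb; omega : 0 < b)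
  refine ge_of_tendsto' hε fun s => ?_
  rw [le_div_iff₀ (by positivity), one_mul]
  exact h.le s

lemma good_of_seq (h : AffineRec b t f L)
    (hε : Tendsto (fun s => f s / (b : ℝ) ^ s) atTop (nhds ε)) {K : ℕ → ℝ} {s₀ : ℕ}
    (hK : ∀ s, s₀ ≤ s → K (s + 1) + (b - 1) * L s ≤ b * K s) (hLK : ∀ s, s₀ ≤ s → L s ≤ K s) :
    ε * b ^ s₀ ≤ f s₀ - L s₀ + K s₀ := by
  have hb : (0 : ℝ) < b := by exact_mod_cast (by have := h.hb; omega : 0 < b)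
  rw [← le_div_iff₀ (by positivity)]
  refine le_of_tendsto hε ?_
  have key : ∀ s, s₀ ≤ s →
      (f s - L s + K s) / (b : ℝ) ^ s ≤ (f s₀ - L s₀ + K s₀) / (b : ℝ) ^ s₀ := by
    intro s hs
    induction s, hs using Nat.le_induction with
    | base => exact le_rfl
    | succ s hs ih =>
      refine le_trans ?_ ih
      rw [div_le_div_iff₀ (by positivity) (by positivity), h.succ, pow_succ]
      have h1 := hK s hs
      have h2 : (0 : ℝ) < b ^ s := by positivity
      nlinarith
  filter_upwards [eventually_ge_atTop s₀] with s hs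
  refine le_trans ?_ (key s hs)
  have := hLK s hs
  gcongr
  linarith

lemma good_step (h : AffineRec b t f L) {s : ℕ} {K K' : ℝ}
    (hg : ε * b ^ (s + 1) ≤ f (s + 1) - L (s + 1) + K) (hK : K + (b - 1) * L s ≤ b * K') :
    ε * b ^ s ≤ f s - L s + K' := by
  have hb : (0 : ℝ) < b := by exact_mod_cast (by have := h.hb; omega : 0 < b)
  rw [h.succ, pow_succ] at hg
  nlinarith

lemma upper (h : AffineRec b t f L)
    (hε : Tendsto (fun s => f s / (b : ℝ) ^ s) atTop (nhds ε)) {K : ℝ}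
    (hg : ε * b ^ (t + t) ≤ f (t + t) - L (t + t) + K) (hK : K ≤ b ^ t + 2 * L t) :
    1 - ε + ε * b ^ t < f t + 1 := by
  have h1 := h.add_eq' le_rfl
  have h2 := h.one_le hε
  have hb : (0 : ℝ) < b := by exact_mod_cast (by have := h.hb; omega : 0 < b)
  have h3 : (0 : ℝ) < b ^ t := by positivity
  rw [pow_add] at hg
  nlinarith

end AffineRec

lemma affineRec_Fv (hSH : StandingHyp) {m n u : ℕ} (hm : 1 ≤ m) (h : EndsFirst n (m + 1) u) :
    AffineRec (m + 1) (Nat.count (Vp m) ((m + 1) ^ u)) (fun s => (Fv m ((m + 1) ^ s) : ℝ))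
      (fun s => (Lv m s : ℝ)) where
  hb := by omega
  zero := by
    have h0 : vl (m + 1) 1 = 0 := by simpa using vl_pow (b := m + 1) (by omega) 0
    have := Fv_succ m 0
    rw [zero_add, h0, Lv_zero hm] at this
    simp [this]
  L_zero := by simp [Lv_zero hm]
  pos := by
    have : 0 < Fv m ((m + 1) ^ Nat.count (Vp m) ((m + 1) ^ u)) :=
      lt_of_lt_of_le (by positivity) (Fv_strictMono m).le_apply
    exact_mod_cast this
  succ s := by
    have := Fv_pow_succ hm s
    rw [eq_sub_iff_add_eq]
    exact_mod_cast this
  add_le s := by exact_mod_cast Lv_add_le hSH hm h s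
  add_eq hs := by exact_mod_cast Lv_add_eq hSH hm h hs
  le s := by exact_mod_cast (Fv_strictMono m).le_apply

/-! ### Growth of `chi`, `av` and `Lv` -/

lemma six_mul_chi_le {b : ℕ} (hb : 3 ≤ b) (a : ℕ) : 6 * chi b a ≤ a ^ 2 + 5 * a := by
  induction a using Nat.strong_induction_on with
  | _ a ih =>
    rcases Nat.eq_zero_or_pos a with rfl | ha
    · simp
    have h1 := ih (a / b) (Nat.div_lt_self ha (by omega))
    have h2 : a % b < b := Nat.mod_lt _ (by omega)
    have h3 : a = b * (a / b) + a % b := (Nat.div_add_mod a b).symm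
    generalize a / b = q at *
    generalize a % b = r at *
    rw [h3, chi_mul_add (by omega) _ h2]
    obtain ⟨c, rfl⟩ : ∃ c, b = c + 3 := ⟨b - 3, by omega⟩
    have h4 : (c + 4) * (6 * chi (c + 3) q) ≤ (c + 4) * (q ^ 2 + 5 * q) :=
      Nat.mul_le_mul_left _ h1
    have h5 : r ≤ r ^ 2 := Nat.le_self_pow (by omega) r
    have h6 : q ≤ q ^ 2 := Nat.le_self_pow (by omega) q
    nlinarith [Nat.zero_le (c ^ 2 * q ^ 2), Nat.zero_le (c * q ^ 2), Nat.zero_le (c * q * r),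
      Nat.zero_le (q * r)]

lemma two_mul_chi_two_le (a : ℕ) : 2 * chi 2 a ≤ a ^ 2 + a := by
  induction a using Nat.strong_induction_on with
  | _ a ih =>
    rcases Nat.eq_zero_or_pos a with rfl | ha
    · simp
    have h1 := ih (a / 2) (Nat.div_lt_self ha (by omega))
    have h2 : a % 2 < 2 := Nat.mod_lt _ (by omega)
    have h3 : a = 2 * (a / 2) + a % 2 := (Nat.div_add_mod a 2).symm
    generalize a / 2 = q at *
    generalize a % 2 = r at *
    rw [h3, chi_mul_add le_rfl _ h2]
    have h5 : r ≤ r ^ 2 := Nat.le_self_pow (by omega) r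
    have h6 : q ≤ q ^ 2 := Nat.le_self_pow (by omega) q
    nlinarith [Nat.zero_le (q * r)]

lemma EndsFirst.one_le {n m u : ℕ} (hm : 1 ≤ m) (h : EndsFirst n m u) : 1 ≤ u := by
  by_contra h0
  have := h.mem
  rw [show u = 0 by omega, Tv_zero hm] at this
  simp at this

lemma Vp_self (hSH : StandingHyp) {j : ℕ} (hj : 1 ≤ j) : Vp j (j + 1) := by
  simpa using Vp_pow hSH hj (endsFirst_one hSH (m := j + 1) (by omega))

lemma succ_le_count_add_div (hSH : StandingHyp) {j : ℕ} (hj : 1 ≤ j) (x : ℕ) :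
    x + 1 ≤ Nat.count (Vp j) (x + 1) + x / (j + 1) := by
  induction x with
  | zero => rw [Nat.count_succ, if_pos (Vp_zero hj)]; simp
  | succ x ih =>
    rw [Nat.count_succ, Nat.succ_div]
    split_ifs with h1 h2 h3
    · omega
    · omega
    · omega
    · exact absurd (Vp_of_not_dvd hSH hj h3) h1

lemma add_two_le_count_add_div (hSH : StandingHyp) {j : ℕ} (hj : 1 ≤ j) {x : ℕ} (hx : j + 1 ≤ x) :
    x + 2 ≤ Nat.count (Vp j) (x + 1) + x / (j + 1) := by
  induction x, hx using Nat.le_induction with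
  | base =>
    have := succ_le_count_add_div hSH hj j
    rw [Nat.div_eq_of_lt (by omega)] at this
    rw [Nat.count_succ, if_pos (Vp_self hSH hj), Nat.div_self (by omega)]
    omega
  | succ x hx ih =>
    rw [Nat.count_succ, Nat.succ_div]
    split_ifs with h1 h2 h3
    · omega
    · omega
    · omega
    · exact absurd (Vp_of_not_dvd hSH hj h3) h1

lemma le_count_pow (hSH : StandingHyp) {j u : ℕ} (hj : 1 ≤ j) (hu : 1 ≤ u) :
    j + 1 ≤ Nat.count (Vp j) ((j + 1) ^ u) := by
  have h1 := succ_le_count_add_div hSH hj j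
  rw [Nat.div_eq_of_lt (by omega)] at h1
  exact h1.trans (Nat.count_monotone _ (Nat.le_self_pow (by omega) _))

lemma count_av_succ (hSH : StandingHyp) {j : ℕ} (hj : 1 ≤ j) (v : ℕ) :
    Nat.count (Vp j) (av j v + 1) = v + 1 := by
  rw [Nat.count_succ, if_pos (Vp_av hSH hj v), av,
    Nat.count_nth_of_infinite (infinite_Vp hSH hj)]

lemma av_le_of_lt_count {j v x : ℕ} (h : v < Nat.count (Vp j) (x + 1)) : av j v ≤ x :=
  Nat.lt_succ_iff.1 (Nat.nth_lt_of_lt_count h)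

lemma two_mul_av_lt (hSH : StandingHyp) {j v : ℕ} (hj : 2 ≤ j) (hv : 1 ≤ v) :
    2 * av j v < 3 * v := by
  have h1 := count_av_succ hSH (by omega : 1 ≤ j) v
  rcases lt_or_ge (av j v) (j + 1) with h | h
  · have h2 := succ_le_count_add_div hSH (by omega : 1 ≤ j) (av j v)
    rw [Nat.div_eq_of_lt h] at h2
    omega
  · have h2 := add_two_le_count_add_div hSH (by omega) h
    have h3 : av j v / (j + 1) ≤ av j v / 3 := Nat.div_le_div_left (by omega) (by omega)
    omega

lemma av_one_lt (hSH : StandingHyp) {v : ℕ} (hv : 1 ≤ v) : av 1 v < 2 * v := by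
  have h1 := count_av_succ hSH le_rfl v
  rcases lt_or_ge (av 1 v) 2 with h | h
  · omega
  · have h2 := add_two_le_count_add_div hSH le_rfl h
    omega

lemma av_le_self (hSH : StandingHyp) {j v : ℕ} (hj : 2 ≤ j) (hv : v ≤ 5) : av j v ≤ v := by
  refine av_le_of_lt_count ?_
  rcases lt_or_ge v (j + 1) with h | h
  · have h2 := succ_le_count_add_div hSH (by omega : 1 ≤ j) v
    rw [Nat.div_eq_of_lt h] at h2
    omega
  · have h2 := add_two_le_count_add_div hSH (by omega) h
    have h3 : v / (j + 1) ≤ v / 3 := Nat.div_le_div_left (by omega) (by omega)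
    omega

lemma vsum_two_pow_le {b : ℕ} (hb : 3 ≤ b) (y : ℕ) : vsum b (fun v => 2 ^ v) y ≤ 2 * y := by
  induction y using Nat.strong_induction_on with
  | _ y ih =>
    rcases Nat.eq_zero_or_pos y with rfl | hy
    · simp
    have h1 := ih (y / b) (Nat.div_lt_self hy (by omega))
    have h2 : vsum b (fun v => 2 ^ (v + 1)) (y / b) = 2 * vsum b (fun v => 2 ^ v) (y / b) := by
      rw [vsum, vsum, Finset.mul_sum]
      exact Finset.sum_congr rfl fun _ _ => pow_succ' _ _
    have h3 : y / b ≤ y / 3 := Nat.div_le_div_left hb (by omega)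
    rw [vsum_eq (by omega), h2]
    omega

/-- A majorant of `Lv m` for `2 ≤ m`. -/
def majorant : ℕ → ℕ
  | 0 => 0
  | 1 => 1
  | 2 => 2
  | v + 3 => 3 * 2 ^ v + 2

lemma vsum_majorant_le {b : ℕ} (hb : 3 ≤ b) (y : ℕ) :
    vsum b majorant y ≤ y / b + y / b / b + 6 * (y / b / b / b) := by
  have hb2 : 2 ≤ b := by omega
  have h1 : vsum b (fun v => majorant (v + 1 + 1 + 1)) (y / b / b / b)
      = 3 * vsum b (fun v => 2 ^ v) (y / b / b / b) + 2 * (y / b / b / b) := by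
    simp [vsum, majorant, Finset.sum_add_distrib, Finset.mul_sum, mul_comm]
  have h2 := vsum_two_pow_le hb (y / b / b / b)
  have h3 : y / b / b ≤ y / b := Nat.div_le_self _ _
  have h4 : y / b / b / b ≤ y / b / b := Nat.div_le_self _ _
  rw [vsum_eq hb2, vsum_eq hb2, vsum_eq hb2, h1]
  simp only [majorant]
  omega

lemma Fv_le_of_majorant {m v y : ℕ} (hm : 2 ≤ m) (h : ∀ w < v, Lv m w ≤ majorant w)
    (hy : y < (m + 1) ^ v) :
    Fv m y ≤ y + y / (m + 1) + y / (m + 1) / (m + 1)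
      + 6 * (y / (m + 1) / (m + 1) / (m + 1)) := by
  have h1 : vsum (m + 1) (Lv m) y ≤ vsum (m + 1) majorant y :=
    Finset.sum_le_sum fun x hx => h _ (vl_lt (by omega) (by omega)
      (by have := Finset.mem_range.1 hx; omega))
  have h2 := vsum_majorant_le (b := m + 1) (by omega) y
  rw [Fv_eq]
  omega

lemma Fv_le_of_three_le {m v y : ℕ} (hm : 3 ≤ m) (h : ∀ w < v, Lv m w ≤ majorant w)
    (hy : y < (m + 1) ^ v) : 12 * Fv m y ≤ 17 * y := by
  have h1 := Fv_le_of_majorant (by omega) h hy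
  have h2 : ∀ z, z / (m + 1) ≤ z / 4 := fun z => Nat.div_le_div_left (by omega) (by omega)
  have h3 := h2 y
  have h4 := h2 (y / (m + 1))
  have h5 := h2 (y / (m + 1) / (m + 1))
  omega

lemma mul_le_majorant {v : ℕ} (hv : 7 ≤ v) : 17 * (9 * v ^ 2 + 30 * v) ≤ 288 * majorant v := by
  obtain ⟨w, rfl⟩ : ∃ w, v = w + 4 + 3 := ⟨v - 7, by omega⟩
  have : 17 * (9 * (w + 4 + 3) ^ 2 + 30 * (w + 4 + 3)) ≤ 288 * (3 * 2 ^ (w + 4)) := by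
    induction w with
    | zero => norm_num
    | succ w ih =>
      have h1 := ih (by omega)
      have h2 : 2 ^ (w + 1 + 4) = 2 * 2 ^ (w + 4) := by ring
      nlinarith
  simp only [majorant]
  omega

lemma av_lt_pow (hSH : StandingHyp) {j v : ℕ} (hj : 2 ≤ j) : av j v < (j + 1) ^ v := by
  rcases Nat.eq_zero_or_pos v with rfl | hv
  · have := av_le_self hSH hj (Nat.zero_le 5)
    simp; omega
  · have h1 := two_mul_av_lt hSH hj hv
    have h2 : 3 ^ v ≤ (j + 1) ^ v := Nat.pow_le_pow_left (by omega) v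
    have h3 : 3 * v ≤ 2 * 3 ^ v := by
      clear h1 h2
      induction v, hv using Nat.le_induction with
      | base => norm_num
      | succ v hv ih => rw [pow_succ]; omega
    omega

lemma Lv_le_of_majorant (hSH : StandingHyp) {m v : ℕ} (hm : 2 ≤ m)
    (h : ∀ w < v, Lv (m + 1) w ≤ majorant w) : 12 * Lv m v ≤ 17 * chi (m + 1) (av m v) := by
  rw [Lv_eq hSH (by omega)]
  exact Fv_le_of_three_le (by omega) h (chi_lt_pow (by omega) (av_lt_pow hSH hm))

lemma Lv_le_majorant (hSH : StandingHyp) (v : ℕ) : ∀ m, 2 ≤ m → Lv m v ≤ majorant v := by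
  induction v using Nat.strong_induction_on with
  | _ v ih =>
    intro m hm
    have h1 := Lv_le_of_majorant hSH hm fun w hw => ih w hw (m + 1) (by omega)
    have h2 := six_mul_chi_le (b := m + 1) (by omega) (av m v)
    rcases lt_or_ge v 6 with hv | hv
    · have h3 := av_le_self hSH hm (by omega : v ≤ 5)
      have h4 := (chi_strictMono (b := m + 1) (by omega)).monotone h3
      have h5 := six_mul_chi_le (b := m + 1) (by omega) v
      interval_cases v
      · simp [Lv_zero (by omega : 1 ≤ m)]
      all_goals simp only [majorant]; omega
    · have h3 := two_mul_av_lt hSH hm (by omega : 1 ≤ v)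
      rcases hv.eq_or_lt with rfl | hv
      · have h4 : av m 6 ≤ 8 := by omega
        simp only [majorant]
        nlinarith
      · have h4 := mul_le_majorant (by omega : 7 ≤ v)
        nlinarith

lemma Lv_le_chi (hSH : StandingHyp) {m : ℕ} (hm : 2 ≤ m) (v : ℕ) :
    12 * Lv m v ≤ 17 * chi (m + 1) (av m v) :=
  Lv_le_of_majorant hSH hm fun w _ => Lv_le_majorant hSH w _ (by omega)

lemma Lv_le_quadratic (hSH : StandingHyp) {m : ℕ} (hm : 2 ≤ m) (v : ℕ) :
    96 * Lv m v ≤ 51 * v ^ 2 + 170 * v := by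
  rcases Nat.eq_zero_or_pos v with rfl | hv
  · simp [Lv_zero (by omega : 1 ≤ m)]
  have h1 := Lv_le_chi hSH hm v
  have h2 := six_mul_chi_le (b := m + 1) (by omega) (av m v)
  have h3 := two_mul_av_lt hSH hm hv
  nlinarith

lemma Lv_one_le_chi (hSH : StandingHyp) (v : ℕ) : 3 * Lv 1 v ≤ 5 * chi 2 (av 1 v) := by
  have h1 := Fv_le_of_majorant (m := 2) (v := chi 2 (av 1 v)) (y := chi 2 (av 1 v)) le_rfl
    (fun w _ => Lv_le_majorant hSH w 2 le_rfl) (Nat.lt_pow_self (by omega))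
  rw [Lv_eq hSH le_rfl]
  simp only [Nat.reduceAdd] at h1 ⊢
  omega

lemma Lv_one_le (hSH : StandingHyp) (v : ℕ) : Lv 1 v ≤ 4 * v ^ 2 := by
  rcases Nat.eq_zero_or_pos v with rfl | hv
  · simp [Lv_zero le_rfl]
  have h1 := Lv_one_le_chi hSH v
  have h2 := two_mul_chi_two_le (av 1 v)
  have h3 := av_one_lt hSH hv
  nlinarith

/-! ### The upper estimate -/

section Upper

variable {ε : ℝ}

lemma quadratic_le_three_pow {s : ℕ} (hs : 3 ≤ s) :
    204 * s ^ 2 + 442 * s + 136 ≤ 96 * 3 ^ s + 768 := by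
  induction s, hs using Nat.le_induction with
  | base => norm_num
  | succ s hs ih =>
    have h2 : 3 ^ (s + 1) = 3 * 3 ^ s := by ring
    nlinarith

lemma upper_of_two_le (hSH : StandingHyp) {m n u : ℕ} (hm : 2 ≤ m) (h : EndsFirst n (m + 1) u)
    (hε : Tendsto (fun s => (Fv m ((m + 1) ^ s) : ℝ) / ((m + 1 : ℕ) : ℝ) ^ s) atTop (nhds ε)) :
    1 - ε + ε * ((m + 1 : ℕ) : ℝ) ^ Nat.count (Vp m) ((m + 1) ^ u)
      < Fv m ((m + 1) ^ Nat.count (Vp m) ((m + 1) ^ u)) + 1 := by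
  have hrec := affineRec_Fv hSH (by omega) h
  have hu : 1 ≤ u := h.one_le (by omega)
  have htb := le_count_pow hSH (j := m) (by omega) hu
  have hLt : m + 1 + 1 ≤ Lv m (Nat.count (Vp m) ((m + 1) ^ u)) := by
    rw [Lv_count_pow hSH (by omega) h]
    exact (Nat.le_self_pow (by omega) _).trans (Fv_strictMono _).le_apply
  have hL : ∀ s, 96 * (Lv m s : ℝ) ≤ 51 * (s : ℝ) ^ 2 + 170 * s := fun s => by
    exact_mod_cast Lv_le_quadratic hSH hm s
  have hm2 : (2 : ℝ) ≤ m := by exact_mod_cast hm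
  generalize Nat.count (Vp m) ((m + 1) ^ u) = t at *
  have key : 204 * t ^ 2 + 442 * t + 136 ≤ 96 * (m + 1) ^ t + 192 * Lv m t := by
    have h2 := quadratic_le_three_pow (s := t) (by omega)
    have h3 : 3 ^ t ≤ (m + 1) ^ t := Nat.pow_le_pow_left (by omega) t
    omega
  have keyR : 204 * (t : ℝ) ^ 2 + 442 * t + 136
      ≤ 96 * ((m + 1 : ℕ) : ℝ) ^ t + 192 * (Lv m t : ℝ) := by exact_mod_cast key
  refine hrec.upper hε (K := (51 * (((t + t : ℕ) : ℝ) ^ 2 + ((t + t : ℕ) : ℝ) + 1)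
    + 170 * (((t + t : ℕ) : ℝ) + 1 / 2)) / 96) ?_ ?_
  · refine hrec.good_of_seq hε
      (K := fun s => (51 * ((s : ℝ) ^ 2 + s + 1) + 170 * ((s : ℝ) + 1 / 2)) / 96)
      (fun s _ => ?_) fun s _ => ?_
    · have h1 := hL s
      have h2 : (0 : ℝ) ≤ s := s.cast_nonneg
      push_cast
      nlinarith [mul_nonneg (sub_nonneg.2 hm2) (sub_nonneg.2 h1),
        mul_nonneg (sub_nonneg.2 hm2) h2]
    · have h1 := hL s
      have h2 : (0 : ℝ) ≤ s := s.cast_nonneg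
      nlinarith
  · push_cast at keyR ⊢
    linarith

lemma sixteen_mul_sq_le {t : ℕ} (ht : 12 ≤ t) : 16 * t ^ 2 + 16 * t + 12 ≤ 2 ^ t := by
  induction t, ht using Nat.le_induction with
  | base => norm_num
  | succ t ht ih =>
    have h2 : 2 ^ (t + 1) = 2 * 2 ^ t := by ring
    rw [h2]
    nlinarith

lemma good_one (hSH : StandingHyp) {n u : ℕ} (h : EndsFirst n 2 u)
    (hε : Tendsto (fun s => (Fv 1 (2 ^ s) : ℝ) / ((2 : ℕ) : ℝ) ^ s) atTop (nhds ε)) (s : ℕ) :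
    ε * ((2 : ℕ) : ℝ) ^ s ≤ Fv 1 (2 ^ s) - Lv 1 s + 4 * ((s : ℝ) ^ 2 + 2 * s + 3) := by
  have hL : ∀ s, (Lv 1 s : ℝ) ≤ 4 * (s : ℝ) ^ 2 := fun s => by exact_mod_cast Lv_one_le hSH s
  refine (affineRec_Fv hSH le_rfl h).good_of_seq hε
    (K := fun s => 4 * ((s : ℝ) ^ 2 + 2 * s + 3)) (fun s _ => ?_) fun s _ => ?_
  · have h1 := hL s
    push_cast
    nlinarith
  · have h1 := hL s
    have h2 : (0 : ℝ) ≤ s := s.cast_nonneg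
    nlinarith

lemma upper_one (hSH : StandingHyp) {n u : ℕ} (h : EndsFirst n 2 u)
    (hε : Tendsto (fun s => (Fv 1 (2 ^ s) : ℝ) / ((2 : ℕ) : ℝ) ^ s) atTop (nhds ε))
    (ht : 12 ≤ Nat.count (Vp 1) (2 ^ u)) :
    1 - ε + ε * ((2 : ℕ) : ℝ) ^ Nat.count (Vp 1) (2 ^ u)
      < Fv 1 (2 ^ Nat.count (Vp 1) (2 ^ u)) + 1 := by
  refine (affineRec_Fv hSH le_rfl h).upper hε (good_one hSH h hε _) ?_
  simp only [Nat.reduceAdd]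
  have h1 : (16 * (Nat.count (Vp 1) (2 ^ u) : ℝ) ^ 2 + 16 * (Nat.count (Vp 1) (2 ^ u) : ℝ) + 12)
      ≤ ((2 : ℕ) : ℝ) ^ Nat.count (Vp 1) (2 ^ u) := by exact_mod_cast sixteen_mul_sq_le ht
  have h2 : (0 : ℝ) ≤ Lv 1 (Nat.count (Vp 1) (2 ^ u)) := Nat.cast_nonneg _
  push_cast at h1 ⊢
  linarith

lemma Lv_one_six_le (hSH : StandingHyp) (h : EndsFirst 4 2 3) :
    42 ≤ Lv 1 (Nat.count (Vp 1) (2 ^ 3)) := by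
  have h0 := Lv_count_pow hSH (m := 1) le_rfl h
  simp only [Nat.reduceAdd] at h0
  rw [h0]
  have hmono := Lv_strictMono hSH (m := 2) (by omega)
  have hz := Lv_zero (m := 2) (by omega)
  have h1 : Lv 2 0 < Lv 2 1 := hmono (by omega)
  have h2 : Lv 2 1 < Lv 2 2 := hmono (by omega)
  have h3 : 5 ≤ Lv 2 3 := by
    rw [Lv_eq hSH (by omega)]
    have e1 : 3 ≤ av 2 3 := (av_strictMono hSH (by omega)).le_apply
    have e2 := (chi_strictMono (b := 3) (by omega)).monotone e1
    have e3 : chi 3 3 = 4 := by norm_num [chi, Nat.ofDigits]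
    have e4 : Fv 3 4 = Fv 3 3 + 1 + Lv 3 (vl 4 4) := Fv_succ 3 3
    have e5 : vl 4 4 = 1 := by simpa using vl_pow (b := 4) (by omega) 1
    have e6 : Lv 3 0 < Lv 3 1 := Lv_strictMono hSH (by omega) (by omega)
    have e7 : 3 ≤ Fv 3 3 := (Fv_strictMono 3).le_apply
    have e8 : Fv 3 4 ≤ Fv 3 (chi 3 (av 2 3)) := (Fv_strictMono 3).monotone (e3 ▸ e2)
    rw [e5] at e4
    simp only [Nat.reduceAdd]
    omega
  have f0 := Fv_pow_succ (m := 2) (by omega) 0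
  have f1 := Fv_pow_succ (m := 2) (by omega) 1
  have f2 := Fv_pow_succ (m := 2) (by omega) 2
  have f3 : 1 ≤ Fv 2 1 := (Fv_strictMono 2).le_apply
  norm_num at f0 f1 f2 ⊢
  omega

lemma le_of_halving {G L : ℕ → ℝ} (h : ∀ w, G w ≤ (G (w + 1) + L w) / 2) (h10 : G 10 ≤ 2924)
    (h0 : 3 * L 0 ≤ 5 * (82 : ℕ))
    (h1 : 3 * L 1 ≤ 5 * (84 : ℕ))
    (h2 : 3 * L 2 ≤ 5 * (85 : ℕ))
    (h3 : 3 * L 3 ≤ 5 * (91 : ℕ))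
    (h4 : 3 * L 4 ≤ 5 * (94 : ℕ))
    (h5 : 3 * L 5 ≤ 5 * (109 : ℕ))
    (h6 : 3 * L 6 ≤ 5 * (111 : ℕ))
    (h7 : 3 * L 7 ≤ 5 * (112 : ℕ))
    (h8 : 3 * L 8 ≤ 5 * (118 : ℕ))
    (h9 : 3 * L 9 ≤ 5 * (121 : ℕ)) :
    G 0 ≤ 433 / 3 := by
  push_cast at *
  linarith [h 0, h 1, h 2, h 3, h 4, h 5, h 6, h 7, h 8, h 9]

lemma upper_one_four (hSH : StandingHyp) (h : EndsFirst 4 2 3)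
    (hε : Tendsto (fun s => (Fv 1 (2 ^ s) : ℝ) / ((2 : ℕ) : ℝ) ^ s) atTop (nhds ε)) :
    1 - ε + ε * ((2 : ℕ) : ℝ) ^ Nat.count (Vp 1) (2 ^ 3)
      < Fv 1 (2 ^ Nat.count (Vp 1) (2 ^ 3)) + 1 := by
  have hrec := affineRec_Fv hSH le_rfl h
  have hLt := Lv_one_six_le hSH h
  have hodd : ∀ c, Vp 1 (2 * c + 1) := fun c => Vp_of_not_dvd hSH le_rfl (by omega)
  have h2 : Vp 1 2 := Vp_self hSH le_rfl
  have hsh : ∀ c, Vp 1 (c * 8 + 2) := fun c => by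
    simpa using Vp_shift hSH (c := c) le_rfl h (by omega) (by norm_num) h2
  have hcs : ∀ x, Vp 1 x → Nat.count (Vp 1) (x + 1) = Nat.count (Vp 1) x + 1 := fun x hx => by
    rw [Nat.count_succ, if_pos hx]
  have hcm : ∀ x, Nat.count (Vp 1) x ≤ Nat.count (Vp 1) (x + 1) := fun x =>
    Nat.count_monotone _ (Nat.le_succ x)
  have h16 := count_succ_mul hSH le_rfl h 1
  rw [one_mul, if_pos (Vp_pow hSH le_rfl h)] at h16
  simp only [Nat.reduceAdd, Nat.reducePow, Nat.reduceMul] at h16 hLt ⊢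
  have ht8 : Nat.count (Vp 1) 8 ≤ 8 := Nat.count_le _
  have c3 := hcs 3 (hodd 1)
  have c5 := hcs 5 (hodd 2)
  have c7 := hcs 7 (hodd 3)
  have c0 := hcs 0 (Vp_zero le_rfl)
  have c1 := hcs 1 (hodd 0)
  have c2 := hcs 2 h2
  have m4 := hcm 4
  have m6 := hcm 6
  norm_num at c0 c1 c2 c3 c5 c7 m4 m6
  have c17 := hcs 17 (hodd 8)
  have c18 := hcs 18 (hsh 2)
  have c19 := hcs 19 (hodd 9)
  have c21 := hcs 21 (hodd 10)
  have c23 := hcs 23 (hodd 11)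
  have c25 := hcs 25 (hodd 12)
  have c26 := hcs 26 (hsh 3)
  have c27 := hcs 27 (hodd 13)
  have c29 := hcs 29 (hodd 14)
  have c31 := hcs 31 (hodd 15)
  have m16 := hcm 16
  have m20 := hcm 20
  have m22 := hcm 22
  have m24 := hcm 24
  have m28 := hcm 28
  have m30 := hcm 30
  norm_num at c17 c18 c19 c21 c23 c25 c26 c27 c29 c31 m16 m20 m22 m24 m28 m30
  have hgood := good_one hSH h hε
  have hstep : ∀ s, ε * ((2 : ℕ) : ℝ) ^ s - Fv 1 (2 ^ s) + Lv 1 s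
      ≤ (ε * ((2 : ℕ) : ℝ) ^ (s + 1) - Fv 1 (2 ^ (s + 1)) + Lv 1 (s + 1) + Lv 1 s) / 2 := by
    intro s
    have h1 := hrec.good_step (ε := ε) (s := s)
      (K := ε * ((2 : ℕ) : ℝ) ^ (s + 1) - Fv 1 (2 ^ (s + 1)) + Lv 1 (s + 1))
      (K' := (ε * ((2 : ℕ) : ℝ) ^ (s + 1) - Fv 1 (2 ^ (s + 1)) + Lv 1 (s + 1) + Lv 1 s) / 2)
      (le_of_eq (by simp only [Nat.reduceAdd]; ring)) (by push_cast; linarith)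
    simp only [Nat.reduceAdd] at h1
    linarith
  have hup := fun K => hrec.upper hε (K := K)
  simp only [Nat.reduceAdd, Nat.reducePow] at hup
  generalize Nat.count (Vp 1) 8 = t at *
  have hbound : ∀ w x y : ℕ, t + t + w < Nat.count (Vp 1) (x + 1) → chi 2 x ≤ y →
      3 * (Lv 1 (t + t + w) : ℝ) ≤ 5 * y := fun w x y hx hy => by
    have e1 := Lv_one_le_chi hSH (t + t + w)
    have e2 := (chi_strictMono (b := 2) le_rfl).monotone (av_le_of_lt_count hx)
    exact_mod_cast (by omega : 3 * Lv 1 (t + t + w) ≤ 5 * y)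
  have b0 := hbound 0 17 82 (by simp only [Nat.reduceAdd]; omega) (by norm_num [chi, Nat.ofDigits])
  have b1 := hbound 1 18 84 (by simp only [Nat.reduceAdd]; omega) (by norm_num [chi, Nat.ofDigits])
  have b2 := hbound 2 19 85 (by simp only [Nat.reduceAdd]; omega) (by norm_num [chi, Nat.ofDigits])
  have b3 := hbound 3 21 91 (by simp only [Nat.reduceAdd]; omega) (by norm_num [chi, Nat.ofDigits])
  have b4 := hbound 4 23 94 (by simp only [Nat.reduceAdd]; omega) (by norm_num [chi, Nat.ofDigits])
  have b5 := hbound 5 25 109 (by simp only [Nat.reduceAdd]; omega) (by norm_num [chi, Nat.ofDigits])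
  have b6 := hbound 6 26 111 (by simp only [Nat.reduceAdd]; omega) (by norm_num [chi, Nat.ofDigits])
  have b7 := hbound 7 27 112 (by simp only [Nat.reduceAdd]; omega) (by norm_num [chi, Nat.ofDigits])
  have b8 := hbound 8 29 118 (by simp only [Nat.reduceAdd]; omega) (by norm_num [chi, Nat.ofDigits])
  have b9 := hbound 9 31 121 (by simp only [Nat.reduceAdd]; omega) (by norm_num [chi, Nat.ofDigits])
  have g10 := hgood (t + t + 10)
  have g0 := le_of_halving (G := fun w => ε * ((2 : ℕ) : ℝ) ^ (t + t + w)
      - Fv 1 (2 ^ (t + t + w)) + Lv 1 (t + t + w)) (L := fun w => Lv 1 (t + t + w))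
    (fun w => hstep (t + t + w)) (by
      have h1 : (t : ℝ) ≤ 8 := by exact_mod_cast ht8
      have h0 : (0 : ℝ) ≤ t := t.cast_nonneg
      push_cast at g10
      push_cast
      nlinarith) b0 b1 b2 b3 b4 b5 b6 b7 b8 b9
  refine hup (433 / 3) (by simp only [Nat.add_zero] at g0; linarith) ?_
  have e1 : (2 : ℝ) ^ 6 ≤ 2 ^ t := pow_le_pow_right₀ (by norm_num) (by omega)
  have e2 : (42 : ℝ) ≤ Lv 1 t := by exact_mod_cast hLt
  norm_num at e1
  linarith

end Upper

/-! ### The tower of exponents -/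

lemma exists_endsFirst_of_tower (hSH : StandingHyp) {m n : ℕ} (hm : 1 ≤ m) (hn : 3 < n)
    {ν : ℕ → ℝ}
    (hν : ∀ j, 1 ≤ j → Tendsto (fun x : ℕ => (x : ℝ) / (iota j x : ℝ)) atTop (nhds (ν j)))
    {E : ℕ → ℕ} (hEtop : E (n - 2) = ⌈ν (n - 2) * ((n : ℝ) - 1)⌉₊)
    (hEstep : ∀ j, m ≤ j → j + 3 ≤ n → E j = ⌈ν j * ((j : ℝ) + 1) ^ E (j + 1)⌉₊)
    (d j : ℕ) (hj : m ≤ j) (hd : j + 2 + d = n) :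
    ∃ u, EndsFirst n (j + 1) u ∧ E j = Nat.count (Vp j) ((j + 1) ^ u) ∧
      (d = 0 → u = 1) ∧ (0 < d → u = E (j + 1)) := by
  induction d generalizing j with
  | zero =>
    obtain rfl : n = j + 2 := by omega
    have h1 : EndsFirst (j + 2) (j + 1) 1 := endsFirst_one hSH (by omega)
    refine ⟨1, h1, ?_, fun _ => rfl, fun h => absurd h (by omega)⟩
    have h2 := ceil_mul_eq_count hSH (by omega) h1 hn (hν j (by omega))
    rw [← h2]
    simp only [Nat.add_sub_cancel] at hEtop
    rw [hEtop, pow_one]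
    congr 2
    push_cast
    ring
  | succ d ih =>
    obtain ⟨u, hu, hEu, -⟩ := ih (j + 1) (by omega) (by omega)
    have h1 : EndsFirst n (j + 1) (E (j + 1)) := by
      rw [hEu]
      exact hu.step hSH (by omega)
    refine ⟨E (j + 1), h1, ?_, fun h => absurd h (by omega), fun _ => rfl⟩
    rw [hEstep j hj (by omega)]
    exact ceil_mul_eq_count hSH (by omega) h1 hn (hν j (by omega))

/-- Theorem `full tower`. For `1 ≤ m ≤ n−2`, `(m,n) ≠ (1,3)`:
`φ^(m)(n) = ⌊1 − ε_m + ε_m·(m+1)^{E_m}⌋` where the tower exponents `E_j` are defined by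
downward recursion from `E_{n−2} = ⌈ν_{n−2}·(n−1)⌉`. -/
theorem statement16 (hSH : StandingHyp) (m n : ℕ) (hm : 1 ≤ m) (hmn : m + 2 ≤ n)
    (hne : ¬(m = 1 ∧ n = 3)) (ν : ℕ → ℝ)
    (hν : ∀ j, 1 ≤ j → Tendsto (fun x : ℕ => (x : ℝ) / (iota j x : ℝ)) atTop (nhds (ν j)))
    (ε : ℝ)
    (hε : Tendsto (fun t : ℕ => (beta m t : ℝ) / ((m : ℝ) + 1) ^ (t - 1)) atTop (nhds ε))
    (hocc : ∀ l, m ≤ l → l ≤ n → {p : ℕ | 1 ≤ p ∧ gij l p = n}.Nonempty)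
    (E : ℕ → ℕ)
    (hEtop : E (n - 2) = ⌈ν (n - 2) * ((n : ℝ) - 1)⌉₊)
    (hEstep : ∀ j, m ≤ j → j + 3 ≤ n → E j = ⌈ν j * ((j : ℝ) + 1) ^ E (j + 1)⌉₊) :
    (phi m n : ℤ) = ⌊1 - ε + ε * ((m : ℝ) + 1) ^ E m⌋ := by
  have tower := exists_endsFirst_of_tower hSH hm (by omega) hν hEtop hEstep
  obtain ⟨u, hu, hEu, hu0, hu1⟩ := tower (n - m - 2) m le_rfl (by omega)
  have hlim : Tendsto (fun s => (Fv m ((m + 1) ^ s) : ℝ) / ((m + 1 : ℕ) : ℝ) ^ s) atTop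
      (nhds ε) := by
    refine ((tendsto_add_atTop_iff_nat 1).2 hε).congr fun s => ?_
    simp [beta, piLen_eq hSH hm]
  have hlow := (affineRec_Fv hSH hm hu).lower hlim
  have hupp : 1 - ε + ε * ((m + 1 : ℕ) : ℝ) ^ Nat.count (Vp m) ((m + 1) ^ u)
      < Fv m ((m + 1) ^ Nat.count (Vp m) ((m + 1) ^ u)) + 1 := by
    rcases hm.eq_or_lt with rfl | hm2
    · rcases (show 4 ≤ n by omega).eq_or_lt with rfl | hn
      · obtain ⟨v, -, hEv, hv, -⟩ := tower 0 2 (by omega) (by omega)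
        have hu3 : u = 3 := by
          rw [hu1 (by omega), hEv, hv rfl]
          exact le_antisymm (Nat.count_le _) (le_count_pow hSH (j := 2) (by omega) le_rfl)
        subst hu3
        exact upper_one_four hSH hu hlim
      · obtain ⟨v, -, hEv, -, hv⟩ := tower (n - 4) 2 (by omega) (by omega)
        obtain ⟨w, hw, hEw, -⟩ := tower (n - 5) 3 (by omega) (by omega)
        have hE3 : 4 ≤ E 3 := hEw ▸ le_count_pow hSH (j := 3) (by omega) (hw.one_le (by omega))
        have hE2 : 7 ≤ E 2 := by
          rw [hEv, hv (by omega)]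
          have h1 : 9 ≤ 3 ^ E 3 :=
            le_trans (by norm_num) (Nat.pow_le_pow_right (n := 3) (by omega) hE3)
          have h2 := Nat.count_monotone (Vp 2) h1
          have h3 := succ_le_count_add_div hSH (j := 2) (by omega) 8
          simp only [Nat.reduceAdd, Nat.reduceDiv] at h2 h3 ⊢
          omega
        refine upper_one hSH hu hlim ?_
        have h1 : 128 ≤ 2 ^ u :=
          le_trans (by norm_num) (Nat.pow_le_pow_right (n := 2) (by omega) (hu1 (by omega) ▸ hE2))
        have h2 := Nat.count_monotone (Vp 1) h1
        have h3 := succ_le_count_add_div hSH (j := 1) le_rfl 127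
        simp only [Nat.reduceAdd, Nat.reduceDiv] at h2 h3 ⊢
        omega
    · exact upper_of_two_le hSH hm2 hu hlim
  have hphi : phi m n = Fv m ((m + 1) ^ E m) := by
    have h1 := hu.step hSH hm
    rw [← hEu] at h1
    exact h1.phi_eq hSH hm
  rw [← hEu] at hlow hupp
  rw [hphi, eq_comm, Int.floor_eq_iff]
  push_cast at hlow hupp ⊢
  exact ⟨hlow, hupp⟩
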